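/- arXiv:1804.02776 — 2 statements merged into one kernel-verified Lean document; each statement's English description precedes it below -/
import Mathlib

section
/- For every ε > 0 there exists N ∈ ℕ such that for every n ≥ N, every σ ∈ S_n, and every irreducible complex character χ of S_n other than the trivial and sign characters: 1 - χ̃(σ) ≥ (1 - (c₁(σ)-1)/(n-1))·(1 - ε). (That is, there are constants δ_n > 0 tending to zero such that 1 - χ̃(σ) ≥ [1 - χ̃_std(σ)]·(1 - δ_n) for all σ and all such χ.) -/
open CategoryTheory

/-- `c₁(σ)`: the number of fixed points of a permutation. -/
def fixCount {n : ℕ} (σ : Equiv.Perm (Fin n)) : ℕ :=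
  (Finset.univ.filter fun x => σ x = x).card

/-- `c_ℓ(σ)`: the number of `ℓ`-cycles of a permutation (for `ℓ ≥ 2`). -/
def cyc {n : ℕ} (ℓ : ℕ) (σ : Equiv.Perm (Fin n)) : ℕ :=
  Multiset.count ℓ σ.cycleType

/-- The (real-valued) normalized character `χ̃(σ) = χ(σ)/χ(1)` of `V` at `σ`. -/
noncomputable def normChar {n : ℕ} (V : FDRep ℂ (Equiv.Perm (Fin n)))
    (σ : Equiv.Perm (Fin n)) : ℝ :=
  (V.character σ / V.character 1).re

/-- `V` is an irreducible representation whose character is neither the trivial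
character nor the sign character. -/
def IsNontrivIrr {n : ℕ} (V : FDRep ℂ (Equiv.Perm (Fin n))) : Prop :=
  Simple V ∧ V.character ≠ (fun _ => 1) ∧
    V.character ≠ (fun σ => ((Equiv.Perm.sign σ : ℤ) : ℂ))

/-- The maximum of the normalized characters `F₁(σ), …, F₈(σ)` at `σ` of the eight
irreps `EIGHT_n = {(n-1,1), (n-2,2), (n-3,3), (n-3,2,1), (n-4,4),
(n-1,1)ᵗ, (n-2,2)ᵗ, (n-2,1,1)ᵗ}`. -/
noncomputable def maxF (n : ℕ) (σ : Equiv.Perm (Fin n)) : ℝ :=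
  let c1 : ℝ := fixCount σ
  let c2 : ℝ := cyc 2 σ
  let c3 : ℝ := cyc 3 σ
  let c4 : ℝ := cyc 4 σ
  let e : ℝ := ((Equiv.Perm.sign σ : ℤ) : ℝ)
  let N : ℝ := n
  let F1 := (c1 - 1) / (N - 1)
  let F2 := (c1 * (c1 - 3) / 2 + c2) / (N * (N - 3) / 2)
  let F3 := (c1 * (c1 - 1) * (c1 - 5) / 6 + (c1 - 1) * c2 + c3) / (N * (N - 1) * (N - 5) / 6)
  let F4 := (c1 * (c1 - 2) * (c1 - 4) / 3 - c3) / (N * (N - 2) * (N - 4) / 3)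
  let F5 := (c1 * (c1 - 1) * (c1 - 2) * (c1 - 7) / 24 + (c1 ^ 2 - 3 * c1 - 1) * c2 / 2
      + c2 ^ 2 / 2 + (c1 - 1) * c3 + c4) / (N * (N - 1) * (N - 2) * (N - 7) / 24)
  let F6 := e * F1
  let F7 := e * F2
  let F8 := e * ((c1 - 1) * (c1 - 2) / 2 - c2) / ((N - 1) * (N - 2) / 2)
  max (max (max F1 F2) (max F3 F4)) (max (max F5 F6) (max F7 F8))

section UnitaryRepresentations

variable {G V : Type} [Group G] [NormedAddCommGroup V] [InnerProductSpace ℂ V]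

/-- Every operator of the representation preserves the inner product. -/
def IsUnitaryRep (ρ : Representation ℂ G V) : Prop :=
  ∀ g v w, inner ℂ (ρ g v) (ρ g w) = inner ℂ v w

/-- The only invariant subspaces are the zero space and the whole (nonzero) space. -/
def IsIrrRep {G V : Type} [Group G] [AddCommGroup V] [Module ℂ V]
    (ρ : Representation ℂ G V) : Prop :=
  Nontrivial V ∧ ∀ p : Submodule ℂ V, (∀ g, ∀ v ∈ p, ρ g v ∈ p) → p = ⊥ ∨ p = ⊤

/-- The real part of the normalized character. -/
noncomputable def nchar {G V : Type} [Group G] [AddCommGroup V] [Module ℂ V]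
    (ρ : Representation ℂ G V) (g : G) : ℝ :=
  (LinearMap.trace ℂ V (ρ g)).re / Module.finrank ℂ V

/-- The real part of the matrix coefficient of `g` at `v`. -/
noncomputable def coeff (ρ : Representation ℂ G V) (v : V) (g : G) : ℝ :=
  (inner ℂ v (ρ g v)).re

theorem IsUnitaryRep.inner_left {ρ : Representation ℂ G V} (hρ : IsUnitaryRep ρ) (g : G)
    (v w : V) : inner ℂ (ρ g v) w = inner ℂ v (ρ g⁻¹ w) := by
  rw [← hρ g v (ρ g⁻¹ w), ← Module.End.mul_apply, ← map_mul]
  simp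

theorem coeff_eq_of_fix_left {ρ : Representation ℂ G V} (hρ : IsUnitaryRep ρ) {v : V} {h : G}
    (hv : ρ h v = v) (g : G) : coeff ρ v (h * g) = coeff ρ v g := by
  unfold coeff
  conv_lhs => rw [← hv]
  rw [map_mul, Module.End.mul_apply, hv, ← hρ h v (ρ g v), hv]

theorem coeff_of_fix {ρ : Representation ℂ G V} {v : V} {h : G}
    (hv : ρ h v = v) (h1 : ‖v‖ = 1) : coeff ρ v h = 1 := by
  unfold coeff
  rw [hv, inner_self_eq_norm_sq_to_K, h1]
  simp

theorem abs_coeff_le {ρ : Representation ℂ G V} (hρ : IsUnitaryRep ρ) {v : V} (h1 : ‖v‖ = 1)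
    (g : G) : |coeff ρ v g| ≤ 1 := by
  have h2 : ‖ρ g v‖ = 1 := by
    have := hρ g v v
    rw [inner_self_eq_norm_sq_to_K, inner_self_eq_norm_sq_to_K, h1] at this
    have h3 : ‖ρ g v‖ ^ 2 = 1 ^ 2 := by exact_mod_cast this
    nlinarith [norm_nonneg (ρ g v)]
  calc |coeff ρ v g| ≤ ‖inner ℂ v (ρ g v)‖ := Complex.abs_re_le_norm _
    _ ≤ ‖v‖ * ‖ρ g v‖ := norm_inner_le_norm _ _
    _ = 1 := by rw [h1, h2, one_mul]

theorem nchar_mul_comm (ρ : Representation ℂ G V) (g h : G) :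
    nchar ρ (g * h) = nchar ρ (h * g) := by
  unfold nchar
  rw [map_mul ρ, map_mul ρ, LinearMap.trace_mul_comm]

theorem nchar_conj (ρ : Representation ℂ G V) (g h : G) :
    nchar ρ (h * g * h⁻¹) = nchar ρ g := by
  rw [nchar_mul_comm]
  simp

theorem nchar_eq_of_isConj (ρ : Representation ℂ G V) {g h : G} (hc : IsConj g h) :
    nchar ρ g = nchar ρ h := by
  obtain ⟨c, rfl⟩ := isConj_iff.1 hc
  rw [nchar_conj]

variable [FiniteDimensional ℂ V]

theorem nchar_one [Nontrivial V] (ρ : Representation ℂ G V) : nchar ρ 1 = 1 := by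
  unfold nchar
  have : (Module.finrank ℂ V : ℝ) ≠ 0 := by exact_mod_cast Module.finrank_pos.ne'
  rw [map_one, LinearMap.trace_one]
  simp [this]

theorem IsUnitaryRep.trace_inv {ρ : Representation ℂ G V} (hρ : IsUnitaryRep ρ) (g : G) :
    LinearMap.trace ℂ V (ρ g⁻¹) = starRingEnd ℂ (LinearMap.trace ℂ V (ρ g)) := by
  rw [LinearMap.trace_eq_sum_inner _ (stdOrthonormalBasis ℂ V),
    LinearMap.trace_eq_sum_inner _ (stdOrthonormalBasis ℂ V), map_sum]
  refine Finset.sum_congr rfl fun i _ => ?_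
  rw [← hρ.inner_left, inner_conj_symm]

theorem IsUnitaryRep.nchar_inv {ρ : Representation ℂ G V} (hρ : IsUnitaryRep ρ) (g : G) :
    nchar ρ g⁻¹ = nchar ρ g := by
  unfold nchar
  rw [hρ.trace_inv]
  simp

theorem IsUnitaryRep.nchar_posDef {ρ : Representation ℂ G V} (hρ : IsUnitaryRep ρ)
    {ι : Type*} [Fintype ι] (c : ι → ℝ) (g : ι → G) :
    0 ≤ ∑ i, ∑ j, c i * c j * nchar ρ ((g i)⁻¹ * g j) := by
  unfold nchar
  simp_rw [← mul_div_assoc, ← Finset.sum_div]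
  refine div_nonneg ?_ (Nat.cast_nonneg _)
  have key : ∀ e : V, 0 ≤ ∑ i, ∑ j, c i * c j * (inner ℂ e (ρ ((g i)⁻¹ * g j) e)).re := by
    intro e
    have h := inner_self_nonneg (𝕜 := ℂ) (x := ∑ i, (c i : ℂ) • ρ (g i) e)
    rw [sum_inner] at h
    simp_rw [inner_sum, inner_smul_left, inner_smul_right, hρ.inner_left,
      ← Module.End.mul_apply, ← map_mul] at h
    convert h using 1
    simp [mul_assoc]
  simp_rw [LinearMap.trace_eq_sum_inner _ (stdOrthonormalBasis ℂ V), Complex.re_sum,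
    Finset.mul_sum]
  rw [Finset.sum_congr rfl fun i _ => Finset.sum_comm, Finset.sum_comm]
  exact Finset.sum_nonneg fun i _ => key _

theorem IsUnitaryRep.nchar_le_one [Nontrivial V] {ρ : Representation ℂ G V}
    (hρ : IsUnitaryRep ρ) (g : G) : nchar ρ g ≤ 1 := by
  have h := hρ.nchar_posDef ![1, -1] ![1, g]
  simp [Fin.sum_univ_two, nchar_one, hρ.nchar_inv] at h
  linarith

theorem IsUnitaryRep.neg_one_le_nchar [Nontrivial V] {ρ : Representation ℂ G V}
    (hρ : IsUnitaryRep ρ) (g : G) : -1 ≤ nchar ρ g := by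
  have h := hρ.nchar_posDef ![1, 1] ![1, g]
  simp [Fin.sum_univ_two, nchar_one, hρ.nchar_inv] at h
  linarith

/-- `√(1 - χ̃)` behaves like a length function, up to constants. -/
theorem IsUnitaryRep.one_sub_nchar_mul_le [Nontrivial V] {ρ : Representation ℂ G V}
    (hρ : IsUnitaryRep ρ) (g h : G) :
    1 - nchar ρ (g * h) ≤ 2 * (1 - nchar ρ g) + 2 * (1 - nchar ρ h) := by
  have key := hρ.nchar_posDef ![1, 1, -2] ![1, g * h, g]
  simp [Fin.sum_univ_three, nchar_one, hρ.nchar_inv] at key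
  linarith

theorem IsIrrRep.exists_smul {ρ : Representation ℂ G V} (hρ : IsIrrRep ρ) (S : V →ₗ[ℂ] V)
    (hS : ∀ g v, S (ρ g v) = ρ g (S v)) :
    ∃ μ : ℂ, (∀ v, S v = μ • v) ∧ LinearMap.trace ℂ V S = μ * Module.finrank ℂ V := by
  have := hρ.1
  obtain ⟨μ, hμ⟩ := Module.End.exists_eigenvalue (K := ℂ) S
  have hS' : ∀ v, S v = μ • v := by
    rcases hρ.2 (Module.End.eigenspace S μ) (by
      intro g v hv
      rw [Module.End.mem_eigenspace_iff] at hv ⊢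
      rw [hS, hv, map_smul]) with h | h
    · exact absurd h hμ
    · intro v
      exact Module.End.mem_eigenspace_iff.1 (h ▸ Submodule.mem_top)
  refine ⟨μ, hS', ?_⟩
  have : S = μ • LinearMap.id := by ext v; simp [hS']
  rw [this, map_smul, LinearMap.trace_id, smul_eq_mul]

/-- An operator commuting with an irreducible representation acts as the scalar read off from
its trace. -/
theorem IsIrrRep.re_inner_eq {ρ : Representation ℂ G V} (hρ : IsIrrRep ρ) (S : V →ₗ[ℂ] V)
    (hS : ∀ g v, S (ρ g v) = ρ g (S v)) {v : V} (h1 : ‖v‖ = 1) :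
    (inner ℂ v (S v)).re = (LinearMap.trace ℂ V S).re / Module.finrank ℂ V := by
  have := hρ.1
  have hd : (Module.finrank ℂ V : ℝ) ≠ 0 := by exact_mod_cast Module.finrank_pos.ne'
  obtain ⟨μ, h, ht⟩ := hρ.exists_smul S hS
  rw [h, inner_smul_right, inner_self_eq_norm_sq_to_K, h1, ht]
  simp [hd]

omit [FiniteDimensional ℂ V] in
theorem sum_conj_commute [Fintype G] (ρ : Representation ℂ G V) (g k : G) (v : V) :
    (∑ h, ρ (h * g * h⁻¹)) (ρ k v) = ρ k ((∑ h, ρ (h * g * h⁻¹)) v) := by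
  rw [LinearMap.sum_apply, LinearMap.sum_apply, map_sum]
  refine Fintype.sum_equiv (Equiv.mulLeft k⁻¹) _ _ fun h => ?_
  rw [← Module.End.mul_apply, ← Module.End.mul_apply, ← map_mul, ← map_mul]
  congr 2
  simp [mul_assoc]

/-- A normalized character value is the average of a matrix coefficient over a class. -/
theorem IsIrrRep.card_mul_nchar [Fintype G] {ρ : Representation ℂ G V} (hρ : IsIrrRep ρ)
    {v : V} (h1 : ‖v‖ = 1) (g : G) :
    (Fintype.card G : ℝ) * nchar ρ g = ∑ h, coeff ρ v (h * g * h⁻¹) := by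
  have h := hρ.re_inner_eq _ (sum_conj_commute ρ g) h1
  rw [LinearMap.sum_apply, inner_sum, Complex.re_sum] at h
  unfold coeff
  rw [h, map_sum, Complex.re_sum, Finset.sum_div]
  have : ∀ x, (LinearMap.trace ℂ V (ρ (x * g * x⁻¹))).re / Module.finrank ℂ V = nchar ρ g :=
    fun x => nchar_conj ρ g x
  rw [Finset.sum_congr rfl fun x _ => this x]
  simp

theorem IsIrrRep.card_mul_nchar_mul [Fintype G] {ρ : Representation ℂ G V} (hρ : IsIrrRep ρ)
    (g g' : G) (hr : (LinearMap.trace ℂ V (ρ g')).im = 0) :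
    (Fintype.card G : ℝ) * (nchar ρ g * nchar ρ g') =
      ∑ h, nchar ρ (g * (h * g' * h⁻¹)) := by
  have := hρ.1
  have hd : (Module.finrank ℂ V : ℂ) ≠ 0 := by exact_mod_cast Module.finrank_pos.ne'
  obtain ⟨μ, h, ht⟩ := hρ.exists_smul _ (sum_conj_commute ρ g')
  have h2 : (∑ h, ρ (h * g' * h⁻¹)) = μ • (1 : V →ₗ[ℂ] V) :=
    LinearMap.ext fun v => by rw [h]; rfl
  have h3 : ∀ x : G, LinearMap.trace ℂ V (ρ (x * g' * x⁻¹)) = LinearMap.trace ℂ V (ρ g') := by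
    intro x
    rw [map_mul ρ, LinearMap.trace_mul_comm, ← map_mul ρ]
    simp
  rw [map_sum] at ht
  simp only [h3, Finset.sum_const, Finset.card_univ, nsmul_eq_mul] at ht
  have h4 : ∑ x, LinearMap.trace ℂ V (ρ (g * (x * g' * x⁻¹))) =
      μ * LinearMap.trace ℂ V (ρ g) := by
    simp_rw [map_mul ρ g]
    rw [← map_sum, ← Finset.mul_sum, h2]
    simp
  have h5 : μ = ((Fintype.card G * nchar ρ g' : ℝ) : ℂ) := by
    have h6 : LinearMap.trace ℂ V (ρ g') = ((LinearMap.trace ℂ V (ρ g')).re : ℂ) := by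
      apply Complex.ext <;> simp [hr]
    rw [← mul_left_inj' hd, ← ht, h6]
    unfold nchar
    push_cast
    field_simp
  have h7 : ∑ x, nchar ρ (g * (x * g' * x⁻¹)) =
      (∑ x, LinearMap.trace ℂ V (ρ (g * (x * g' * x⁻¹)))).re / Module.finrank ℂ V := by
    rw [Complex.re_sum, Finset.sum_div]
    rfl
  rw [h7, h4, h5, Complex.re_ofReal_mul]
  unfold nchar
  ring

end UnitaryRepresentations

section PermutationCounting

variable {α : Type} [Fintype α] [DecidableEq α]

theorem card_perm_apply_eq (x y y' : α) :
    (Finset.univ.filter fun h : Equiv.Perm α => h x = y).card =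
      (Finset.univ.filter fun h : Equiv.Perm α => h x = y').card := by
  refine Finset.card_equiv (Equiv.mulLeft (Equiv.swap y y')) fun h => ?_
  simp only [Finset.mem_filter, Finset.mem_univ, true_and, Equiv.coe_mulLeft,
    Equiv.Perm.mul_apply]
  constructor
  · rintro rfl
    simp
  · intro h1
    exact (Equiv.swap y y').injective (by simpa using h1)

/-- A uniform random permutation sends `x` to `y` with probability `1 / n`. -/
theorem card_perm_apply_eq_mul (x y : α) :
    (Finset.univ.filter fun h : Equiv.Perm α => h x = y).card * Fintype.card α =
      Fintype.card (Equiv.Perm α) := by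
  have h := Finset.card_eq_sum_card_fiberwise (s := Finset.univ)
    (f := fun h : Equiv.Perm α => h x) (t := Finset.univ) (by simp)
  rw [Finset.sum_congr rfl fun y' _ => card_perm_apply_eq x y' y] at h
  simpa [mul_comm] using h.symm

theorem card_perm_conj_apply_eq (σ : Equiv.Perm α) {b b' b'' : α} (h' : b' ≠ b) (h'' : b'' ≠ b) :
    (Finset.univ.filter fun h : Equiv.Perm α => σ (h b) = h b').card =
      (Finset.univ.filter fun h : Equiv.Perm α => σ (h b) = h b'').card := by
  refine Finset.card_equiv (Equiv.mulRight (Equiv.swap b' b'')) fun h => ?_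
  simp [Equiv.swap_apply_of_ne_of_ne h'.symm h''.symm]

/-- A uniform random conjugate of a permutation sends `b` to a given `b' ≠ b` with probability at
most `1 / (n - 1)`. -/
theorem card_perm_conj_apply_eq_mul_le (σ : Equiv.Perm α) {b b' : α} (h' : b' ≠ b) :
    (Finset.univ.filter fun h : Equiv.Perm α => σ (h b) = h b').card * (Fintype.card α - 1) ≤
      Fintype.card (Equiv.Perm α) := by
  have h := Finset.card_eq_sum_card_fiberwise (s := Finset.univ)
    (f := fun h : Equiv.Perm α => h⁻¹ (σ (h b))) (t := Finset.univ) (by simp)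
  rw [← Finset.card_univ (α := Equiv.Perm α), h]
  refine le_trans ?_ (Finset.sum_le_sum_of_subset (Finset.erase_subset b Finset.univ))
  rw [Finset.sum_congr rfl (g := fun _ =>
    (Finset.univ.filter fun h : Equiv.Perm α => σ (h b) = h b').card)]
  · simp [mul_comm, Finset.card_erase_of_mem]
  · intro b'' hb''
    rw [card_perm_conj_apply_eq σ h' (Finset.ne_of_mem_erase hb'')]
    congr 1
    ext h
    simp [Equiv.symm_apply_eq]

end PermutationCounting

section SymmetricGroupRepresentations

variable {α V : Type} [Fintype α] [DecidableEq α] [NormedAddCommGroup V] [InnerProductSpace ℂ V]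

open Equiv Equiv.Perm

/-- `v` is fixed by all permutations fixing `B` pointwise. -/
def FixedOff (ρ : Representation ℂ (Perm α) V) (B : Finset α) (v : V) : Prop :=
  ∀ g : Perm α, (∀ b ∈ B, g b = b) → ρ g v = v

variable {ρ : Representation ℂ (Perm α) V} {B : Finset α} {v : V}

theorem FixedOff.sum_swap_eq_zero (hv : FixedOff ρ B v)
    (hmin : ∀ B' : Finset α, B'.card < B.card → ∀ w, FixedOff ρ B' w → w = 0) {b : α}
    (hb : b ∈ B) : ∑ y ∈ (B.erase b)ᶜ, ρ (swap b y) v = 0 := by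
  refine hmin (B.erase b) (Finset.card_erase_lt_of_mem hb) _ fun g hg => ?_
  rw [map_sum]
  refine Finset.sum_equiv g (fun y => ?_) fun y hy => ?_
  · rw [Finset.mem_compl, Finset.mem_compl, not_iff_not]
    refine ⟨fun h => by rwa [hg y h], fun h => ?_⟩
    rwa [← g.injective (hg _ h)]
  · rw [Finset.mem_compl] at hy
    have h1 : g * swap b y = swap b (g y) * (swap b (g y) * g * swap b y) := by
      rw [← mul_assoc, ← mul_assoc, swap_mul_self, one_mul]
    have h2 : ρ (swap b (g y) * g * swap b y) v = v := by
      refine hv _ fun c hc => ?_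
      by_cases hcb : c = b
      · simp [hcb]
      · have hc' : c ∈ B.erase b := Finset.mem_erase.2 ⟨hcb, hc⟩
        have h3 : c ≠ y := fun h => hy (h ▸ hc')
        have h4 : c ≠ g y := fun h => h3 (g.injective (by rw [hg c hc', h]))
        simp [swap_apply_of_ne_of_ne hcb h3, hg c hc', swap_apply_of_ne_of_ne hcb h4]
    rw [← Module.End.mul_apply, ← map_mul, h1, map_mul, Module.End.mul_apply, h2]

theorem FixedOff.sum_coeff_eq_zero (hv : FixedOff ρ B v)
    (hmin : ∀ B' : Finset α, B'.card < B.card → ∀ w, FixedOff ρ B' w → w = 0) {b : α}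
    (hb : b ∈ B) (g : Perm α) : ∑ y ∈ (B.erase b)ᶜ, coeff ρ v (g * swap b y) = 0 := by
  unfold coeff
  simp_rw [map_mul, Module.End.mul_apply]
  rw [← Complex.re_sum, ← inner_sum, ← map_sum, hv.sum_swap_eq_zero hmin hb]
  simp

theorem compl_erase_eq_insert_compl {b : α} : (B.erase b)ᶜ = insert b Bᶜ := by
  ext y
  simp only [Finset.mem_compl, Finset.mem_erase, Finset.mem_insert]
  tauto

theorem FixedOff.coeff_add_sum (hv : FixedOff ρ B v)
    (hmin : ∀ B' : Finset α, B'.card < B.card → ∀ w, FixedOff ρ B' w → w = 0) {b : α}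
    (hb : b ∈ B) (g : Perm α) : coeff ρ v g + ∑ y ∈ Bᶜ, coeff ρ v (g * swap b y) = 0 := by
  have h := hv.sum_coeff_eq_zero hmin hb g
  rw [compl_erase_eq_insert_compl, Finset.sum_insert (by simpa using hb)] at h
  rwa [swap_self, ← Perm.one_def, mul_one] at h

omit [Fintype α] [DecidableEq α] in
theorem FixedOff.coeff_one (h1 : ‖v‖ = 1) : coeff ρ v 1 = 1 := coeff_of_fix (by simp) h1

omit [Fintype α] in
theorem FixedOff.coeff_swap (hv : FixedOff ρ B v) (h1 : ‖v‖ = 1) {x y : α} (hx : x ∉ B)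
    (hy : y ∉ B) : coeff ρ v (swap x y) = 1 :=
  coeff_of_fix (hv _ fun _ hb => swap_apply_of_ne_of_ne (fun h => hx (h ▸ hb))
    fun h => hy (h ▸ hb)) h1

/-- The rows of the table of coefficients at transpositions. -/
theorem FixedOff.sum_sum_coeff_swap_le (hρ : IsUnitaryRep ρ) (hv : FixedOff ρ B v) (h1 : ‖v‖ = 1)
    (hmin : ∀ B' : Finset α, B'.card < B.card → ∀ w, FixedOff ρ B' w → w = 0) :
    ∑ u, ∑ w, coeff ρ v (swap u w) ≤
      B.card * (B.card - 1) + (Fintype.card α - B.card) ^ 2 - B.card := by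
  have hcard : ((Bᶜ.card : ℕ) : ℝ) = Fintype.card α - B.card := by
    rw [Finset.card_compl, Nat.cast_sub (Finset.card_le_univ B)]
  have hrow : ∀ u ∈ B, ∑ w ∈ Bᶜ, coeff ρ v (swap u w) = -1 := fun u hu => by
    have := hv.coeff_add_sum hmin hu 1
    simp only [one_mul, FixedOff.coeff_one h1] at this
    linarith
  have hBB : ∀ u ∈ B, ∑ w ∈ B, coeff ρ v (swap u w) ≤ B.card := fun u hu => by
    refine (Finset.sum_le_card_nsmul _ _ 1 fun w _ =>
      (abs_le.1 (abs_coeff_le hρ h1 (swap u w))).2).trans_eq (by simp)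
  rw [← Finset.sum_add_sum_compl B]
  have hA : ∑ u ∈ B, ∑ w, coeff ρ v (swap u w) ≤ B.card * (B.card - 1) := by
    refine (Finset.sum_le_card_nsmul _ _ ((B.card : ℝ) - 1) fun u hu => ?_).trans_eq (by simp)
    rw [← Finset.sum_add_sum_compl B, hrow u hu]
    linarith [hBB u hu]
  have hC : ∑ u ∈ Bᶜ, ∑ w, coeff ρ v (swap u w) = (Fintype.card α - B.card) ^ 2 - B.card := by
    simp_rw [← Finset.sum_add_sum_compl B, Finset.sum_add_distrib]
    rw [Finset.sum_comm (s := Bᶜ) (t := B), Finset.sum_congr rfl (g := fun _ => (-1 : ℝ)),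
      Finset.sum_congr (s₁ := Bᶜ) rfl (g := fun _ => ((Bᶜ.card : ℕ) : ℝ))]
    · simp only [Finset.sum_const, nsmul_eq_mul, hcard]
      ring
    · intro u hu
      rw [Finset.sum_congr rfl fun w hw => hv.coeff_swap h1 (Finset.mem_compl.1 hu)
        (Finset.mem_compl.1 hw)]
      simp
    · intro u hu
      rw [← hrow u hu]
      simp_rw [swap_comm]
  linarith

theorem FixedOff.abs_coeff_mul_le (hρ : IsUnitaryRep ρ) (hv : FixedOff ρ B v) (h1 : ‖v‖ = 1)
    (hmin : ∀ B' : Finset α, B'.card < B.card → ∀ w, FixedOff ρ B' w → w = 0)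
    {g : Perm α} {b : α} (hb : b ∈ B) (hgb : g b ∉ B) :
    |coeff ρ v g| * (Fintype.card α - 2 * B.card + 1) ≤ B.card := by
  have hcard : ((Bᶜ.card : ℕ) : ℝ) = Fintype.card α - B.card := by
    rw [Finset.card_compl, Nat.cast_sub (Finset.card_le_univ B)]
  have h := hv.coeff_add_sum hmin hb g
  have hswap : ∀ y, g * swap b y = swap (g b) (g y) * g := fun y =>
    mul_swap_eq_swap_mul g b y
  rw [← Finset.sum_filter_add_sum_filter_not _ (fun y => g y ∈ B)] at h
  rw [Finset.sum_congr (s₁ := Bᶜ.filter fun y => g y ∉ B) rfl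
    (g := fun _ => coeff ρ v g)] at h
  · have hcnt : (Bᶜ.filter fun y => g y ∈ B).card ≤ B.card :=
      Finset.card_le_card_of_injOn g (fun y hy => (Finset.mem_filter.1 hy).2) g.injective.injOn
    have hsum := Finset.card_filter_add_card_filter_not (s := Bᶜ) (fun y => g y ∈ B)
    have hS : |∑ y ∈ Bᶜ.filter (fun y => g y ∈ B), coeff ρ v (g * swap b y)| ≤
        (Bᶜ.filter fun y => g y ∈ B).card :=
      (Finset.abs_sum_le_sum_abs _ _).trans
        ((Finset.sum_le_card_nsmul _ _ 1 fun y _ => abs_coeff_le hρ h1 _).trans_eq (by simp))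
    rw [Finset.sum_const, nsmul_eq_mul] at h
    set m := (Bᶜ.filter fun y => g y ∈ B).card
    set m' := (Bᶜ.filter fun y => g y ∉ B).card
    have h2 : (m : ℝ) + m' = Fintype.card α - B.card := by rw [← hcard]; exact_mod_cast hsum
    have h3 : (m : ℝ) ≤ B.card := by exact_mod_cast hcnt
    have h4 : |coeff ρ v g| * (1 + m') = |∑ y ∈ Bᶜ.filter (fun y => g y ∈ B),
        coeff ρ v (g * swap b y)| := by
      rw [← abs_neg (∑ y ∈ Bᶜ.filter (fun y => g y ∈ B), coeff ρ v (g * swap b y)),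
        ← abs_of_nonneg (show (0 : ℝ) ≤ 1 + m' by positivity), ← abs_mul]
      congr 1
      linarith
    nlinarith [abs_nonneg (coeff ρ v g)]
  · intro y hy
    rw [Finset.mem_filter] at hy
    rw [hswap, coeff_eq_of_fix_left hρ]
    exact hv _ fun c hc => swap_apply_of_ne_of_ne (fun h => hgb (h ▸ hc)) fun h => hy.2 (h ▸ hc)

end SymmetricGroupRepresentations

section LowLevel

variable {α V : Type} [Fintype α] [DecidableEq α] [NormedAddCommGroup V] [InnerProductSpace ℂ V]

open Equiv Equiv.Perm

/-- A unitary irreducible representation of the symmetric group, other than the trivial and sign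
representations. -/
structure GoodRep (ρ : Representation ℂ (Perm α) V) : Prop where
  unitary : IsUnitaryRep ρ
  irr : IsIrrRep ρ
  no_inv : ∀ v, (∀ g, ρ g v = v) → v = 0
  no_sgn : ∀ v, (∀ g, ρ g v = ((sign g : ℤ) : ℂ) • v) → v = 0

variable {ρ : Representation ℂ (Perm α) V} {B : Finset α} {v : V}

omit [Fintype α] [DecidableEq α] in
theorem FixedOff.smul (hv : FixedOff ρ B v) (c : ℂ) : FixedOff ρ B (c • v) := fun g hg => by
  rw [map_smul, hv g hg]

omit [Fintype α] [DecidableEq α] in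
theorem FixedOff.exists_unit (hv : FixedOff ρ B v) (h0 : v ≠ 0) :
    ∃ w, ‖w‖ = 1 ∧ FixedOff ρ B w :=
  ⟨(((‖v‖)⁻¹ : ℝ) : ℂ) • v, by
    rw [norm_smul, Complex.norm_real, norm_inv, norm_norm, inv_mul_cancel₀ (norm_ne_zero_iff.2 h0)],
    hv.smul _⟩

theorem GoodRep.exists_minimal (hρ : GoodRep ρ) : ∃ (B : Finset α) (v : V), ‖v‖ = 1 ∧
    FixedOff ρ B v ∧ 0 < B.card ∧
    ∀ B' : Finset α, B'.card < B.card → ∀ w, FixedOff ρ B' w → w = 0 := by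
  classical
  have := hρ.irr.1
  obtain ⟨v₀, hv₀⟩ := exists_ne (0 : V)
  have hne : (Finset.univ.filter fun B : Finset α => ∃ w, FixedOff ρ B w ∧ w ≠ 0).Nonempty := by
    refine ⟨Finset.univ, Finset.mem_filter.2 ⟨Finset.mem_univ _, v₀, fun g hg => ?_, hv₀⟩⟩
    have : g = 1 := Equiv.ext fun x => hg x (Finset.mem_univ x)
    simp [this]
  obtain ⟨B, hB, hmin⟩ := Finset.exists_min_image _ Finset.card hne
  obtain ⟨-, w, hw, hw0⟩ := Finset.mem_filter.1 hB
  obtain ⟨v, h1, hv⟩ := hw.exists_unit hw0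
  refine ⟨B, v, h1, hv, ?_, fun B' hB' w' hw' => ?_⟩
  · rw [Finset.card_pos, Finset.nonempty_iff_ne_empty]
    rintro rfl
    exact hw0 (hρ.no_inv w fun g => hw g (by simp))
  · by_contra h0
    exact absurd (hmin B' (Finset.mem_filter.2 ⟨Finset.mem_univ _, w', hw', h0⟩)) (not_le.2 hB')

theorem fixedOff_erase (ρ : Representation ℂ (Perm α) V) (x : α) (v : V) :
    FixedOff ρ (Finset.univ.erase x) v := fun g hg => by
  have : g = 1 := by
    refine Equiv.ext fun y => ?_
    by_cases hy : y = x
    · by_contra hne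
      have h2 : g (g y) = g y := hg _ (Finset.mem_erase.2 ⟨hy ▸ hne, Finset.mem_univ _⟩)
      exact hne (g.injective h2)
    · exact hg y (Finset.mem_erase.2 ⟨hy, Finset.mem_univ _⟩)
  simp [this]

theorem card_le_of_minimal [Nontrivial V]
    (hmin : ∀ B' : Finset α, B'.card < B.card → ∀ w, FixedOff ρ B' w → w = 0) (x : α) :
    B.card + 1 ≤ Fintype.card α := by
  by_contra h
  obtain ⟨v₀, hv₀⟩ := exists_ne (0 : V)
  have hc : (Finset.univ.erase x).card < B.card := by
    have : 0 < Fintype.card α := Fintype.card_pos_iff.2 ⟨x⟩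
    rw [Finset.card_erase_of_mem (Finset.mem_univ x), Finset.card_univ]
    omega
  exact hv₀ (hmin _ hc v₀ (fixedOff_erase ρ x v₀))

variable [FiniteDimensional ℂ V]

omit [Fintype α] [FiniteDimensional ℂ V] in
theorem nchar_swap_eq {x y : α} (hxy : x ≠ y) {u w : α} (huw : u ≠ w) :
    nchar ρ (swap u w) = nchar ρ (swap x y) := by
  refine nchar_eq_of_isConj ρ (isConj_swap huw hxy)

theorem GoodRep.sum_sum_coeff_swap (hρ : GoodRep ρ) (h1 : ‖v‖ = 1) {x y : α} (hxy : x ≠ y) :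
    ∑ u, ∑ w, coeff ρ v (swap u w) =
      Fintype.card α + Fintype.card α * (Fintype.card α - 1) * nchar ρ (swap x y) := by
  have := hρ.irr.1
  have h := hρ.irr.re_inner_eq (∑ u, ∑ w, ρ (swap u w)) (by
    intro g v
    simp only [LinearMap.sum_apply, map_sum]
    refine Fintype.sum_equiv g.symm _ _ fun u => Fintype.sum_equiv g.symm _ _ fun w => ?_
    rw [← Module.End.mul_apply, ← Module.End.mul_apply, ← map_mul, ← map_mul,
      mul_swap_eq_swap_mul]
    simp) h1
  simp only [LinearMap.sum_apply, inner_sum, map_sum, Complex.re_sum, Finset.sum_div] at h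
  refine h.trans ?_
  have hrow : ∀ u : α, ∑ w, nchar ρ (swap u w) =
      1 + (Fintype.card α - 1) * nchar ρ (swap x y) := fun u => by
    rw [← Finset.add_sum_erase _ _ (Finset.mem_univ u),
      Finset.sum_congr rfl fun w hw => nchar_swap_eq hxy (Finset.ne_of_mem_erase hw).symm,
      swap_self, ← Perm.one_def, nchar_one, Finset.sum_const,
      Finset.card_erase_of_mem (Finset.mem_univ u), Finset.card_univ, nsmul_eq_mul,
      Nat.cast_sub (Fintype.card_pos_iff.2 ⟨u⟩), Nat.cast_one]
  change ∑ u, ∑ w, nchar ρ (swap u w) = _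
  rw [Finset.sum_congr rfl fun u _ => hrow u, Finset.sum_const, Finset.card_univ, nsmul_eq_mul]
  ring

theorem GoodRep.le_one_sub_nchar_swap (hρ : GoodRep ρ) (hv : FixedOff ρ B v) (h1 : ‖v‖ = 1)
    (hmin : ∀ B' : Finset α, B'.card < B.card → ∀ w, FixedOff ρ B' w → w = 0)
    {x y : α} (hxy : x ≠ y) :
    2 * (B.card : ℝ) * (Fintype.card α - B.card) + 2 * B.card ≤
      Fintype.card α * (Fintype.card α - 1) * (1 - nchar ρ (swap x y)) := by
  have h2 := hv.sum_sum_coeff_swap_le hρ.unitary h1 hmin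
  rw [hρ.sum_sum_coeff_swap h1 hxy] at h2
  linarith

theorem GoodRep.abs_nchar_le_of_derangement (hρ : GoodRep ρ) (hv : FixedOff ρ B v) (h1 : ‖v‖ = 1)
    (hB : 0 < B.card)
    (hmin : ∀ B' : Finset α, B'.card < B.card → ∀ w, FixedOff ρ B' w → w = 0)
    (hBc : 2 * B.card ≤ Fintype.card α) {σ : Perm α} (hσ : ∀ x, σ x ≠ x) :
    |nchar ρ σ| ≤ B.card / (Fintype.card α - 1) +
      B.card / (Fintype.card α - 2 * B.card + 1) := by
  obtain ⟨b, hb⟩ := Finset.card_pos.1 hB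
  have hn : (0 : ℝ) < Fintype.card α - 1 := by
    have : (2 : ℝ) ≤ Fintype.card α := by exact_mod_cast (by omega : 2 ≤ Fintype.card α)
    linarith
  have hn2 : (0 : ℝ) < Fintype.card α - 2 * B.card + 1 := by
    have : (2 : ℝ) * B.card ≤ Fintype.card α := by exact_mod_cast hBc
    linarith
  have hfac : (0 : ℝ) < Fintype.card (Perm α) := by exact_mod_cast Fintype.card_pos
  have hbad : ((Finset.univ.filter fun h : Perm α => h⁻¹ (σ (h b)) ∈ B).card : ℝ) *
      (Fintype.card α - 1) ≤ B.card * Fintype.card (Perm α) := by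
    have hfib := Finset.card_eq_sum_card_fiberwise (f := fun h : Perm α => h⁻¹ (σ (h b)))
      (s := Finset.univ.filter fun h : Perm α => h⁻¹ (σ (h b)) ∈ B) (t := B)
      (fun h hh => (Finset.mem_filter.1 hh).2)
    rw [hfib, Nat.cast_sum, Finset.sum_mul, ← nsmul_eq_mul]
    refine Finset.sum_le_card_nsmul _ _ _ fun b' hb' => ?_
    by_cases hbb : b' = b
    · rw [Finset.card_eq_zero.2, Nat.cast_zero, zero_mul]
      · exact hfac.le
      · refine Finset.filter_eq_empty_iff.2 fun h _ hh => hσ (h b) ?_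
        rw [inv_eq_iff_eq] at hh
        rw [hh, hbb]
    · have h3 := card_perm_conj_apply_eq_mul_le σ hbb
      have h4 : ((Fintype.card α - 1 : ℕ) : ℝ) = Fintype.card α - 1 := by
        rw [Nat.cast_sub (Fintype.card_pos_iff.2 ⟨b⟩), Nat.cast_one]
      rw [← h4]
      refine le_trans ?_ (Nat.cast_le.2 h3)
      rw [Nat.cast_mul]
      refine mul_le_mul_of_nonneg_right (Nat.cast_le.2 (Finset.card_le_card fun h hh => ?_))
        (Nat.cast_nonneg _)
      rw [Finset.mem_filter] at hh ⊢
      exact ⟨Finset.mem_univ _, inv_eq_iff_eq.1 hh.2⟩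
  have hF : ∀ h : Perm α, |coeff ρ v (h⁻¹ * σ * h)| ≤
      (if h⁻¹ (σ (h b)) ∈ B then 1 else 0) + B.card / (Fintype.card α - 2 * B.card + 1) := by
    intro h
    split_ifs with hh
    · have := abs_coeff_le hρ.unitary h1 (h⁻¹ * σ * h)
      have : (0 : ℝ) ≤ B.card / (Fintype.card α - 2 * B.card + 1) := by positivity
      linarith
    · rw [zero_add, le_div_iff₀ hn2]
      exact hv.abs_coeff_mul_le hρ.unitary h1 hmin hb hh
  have hsum : (Fintype.card (Perm α) : ℝ) * |nchar ρ σ| ≤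
      (Finset.univ.filter fun h : Perm α => h⁻¹ (σ (h b)) ∈ B).card +
        Fintype.card (Perm α) * (B.card / (Fintype.card α - 2 * B.card + 1)) := by
    rw [← abs_of_pos hfac, ← abs_mul, hρ.irr.card_mul_nchar h1, abs_of_pos hfac]
    rw [Fintype.sum_equiv (Equiv.inv (Perm α)) _ (fun h => coeff ρ v (h⁻¹ * σ * h))
      (fun h => by simp)]
    refine (Finset.abs_sum_le_sum_abs _ _).trans
      ((Finset.sum_le_sum fun h _ => hF h).trans_eq ?_)
    rw [Finset.sum_add_distrib]
    simp
  have h5 : ((Finset.univ.filter fun h : Perm α => h⁻¹ (σ (h b)) ∈ B).card : ℝ) ≤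
      Fintype.card (Perm α) * (B.card / (Fintype.card α - 1)) := by
    rw [mul_div_assoc', le_div_iff₀ hn, mul_comm (Fintype.card (Perm α) : ℝ)]
    exact hbad
  refine le_of_mul_le_mul_left ?_ hfac
  rw [mul_add]
  linarith

theorem GoodRep.nchar_of_fixedOff_singleton (hρ : GoodRep ρ) {b : α} (hv : FixedOff ρ {b} v)
    (h0 : v ≠ 0) (hn : 2 ≤ Fintype.card α) (σ : Perm α) :
    nchar ρ σ = (((Finset.univ.filter fun x => σ x = x).card : ℝ) - 1) /
      (Fintype.card α - 1) := by
  obtain ⟨w, h1, hw⟩ := hv.exists_unit h0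
  have hmin : ∀ B' : Finset α, B'.card < ({b} : Finset α).card → ∀ w, FixedOff ρ B' w → w = 0 := by
    intro B' hB' w hw
    rw [Finset.card_singleton, Nat.lt_one_iff, Finset.card_eq_zero] at hB'
    subst hB'
    exact hρ.no_inv w fun g => hw g (by simp)
  have hn1 : (Fintype.card α : ℝ) - 1 ≠ 0 := by
    have : (2 : ℝ) ≤ Fintype.card α := by exact_mod_cast hn
    linarith
  have hfac : (Fintype.card (Perm α) : ℝ) ≠ 0 := by exact_mod_cast Fintype.card_ne_zero
  have hF : ∀ g : Perm α, coeff ρ w g =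
      -1 / (Fintype.card α - 1) + if g b = b then 1 + 1 / ((Fintype.card α : ℝ) - 1) else 0 := by
    intro g
    split_ifs with hg
    · rw [coeff_of_fix (hw g (by simpa using hg)) h1]
      ring
    · have h := hw.coeff_add_sum hmin (Finset.mem_singleton_self b) g
      have hmem : g⁻¹ b ∈ ({b} : Finset α)ᶜ := by
        rw [Finset.mem_compl, Finset.mem_singleton, inv_eq_iff_eq]
        exact fun h => hg h.symm
      have hfix : coeff ρ w (g * swap b (g⁻¹ b)) = 1 := coeff_of_fix (hw _ (by simp)) h1
      rw [← Finset.add_sum_erase _ _ hmem, hfix,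
        Finset.sum_congr rfl (g := fun _ => coeff ρ w g)] at h
      · rw [Finset.sum_const, Finset.card_erase_of_mem hmem, Finset.card_compl,
          Finset.card_singleton, nsmul_eq_mul, Nat.sub_sub, Nat.cast_sub (by omega)] at h
        push_cast at h
        field_simp
        linarith
      · intro y hy
        rw [Finset.mem_erase, Finset.mem_compl, Finset.mem_singleton, ne_eq, eq_inv_iff_eq] at hy
        rw [mul_swap_eq_swap_mul, coeff_eq_of_fix_left hρ.unitary]
        exact hw _ (by
          simpa using swap_apply_of_ne_of_ne (fun h => hg h.symm) (fun h => hy.1 h.symm))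
  have hcount : ((Finset.univ.filter fun h : Perm α => (h * σ * h⁻¹) b = b).card : ℝ) *
      Fintype.card α =
      (Finset.univ.filter fun x => σ x = x).card * Fintype.card (Perm α) := by
    have h2 : (Finset.univ.filter fun h : Perm α => (h * σ * h⁻¹) b = b).card =
        ∑ x ∈ Finset.univ.filter (fun x => σ x = x),
          (Finset.univ.filter fun h : Perm α => h x = b).card := by
      refine (Finset.card_eq_sum_card_fiberwise (f := fun h : Perm α => h⁻¹ b)
        (t := Finset.univ.filter (fun x => σ x = x)) ?_).trans ?_
      · intro h hh
        have := (Finset.mem_filter.1 hh).2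
        rw [Finset.mem_coe, Finset.mem_filter]
        refine ⟨Finset.mem_univ _, ?_⟩
        rw [Perm.mul_apply, Perm.mul_apply] at this
        rw [eq_inv_iff_eq, this]
      · refine Finset.sum_congr rfl fun x hx => ?_
        have hx' : σ x = x := (Finset.mem_filter.1 hx).2
        rw [Finset.filter_filter]
        refine congrArg _ (Finset.filter_congr fun h _ => ⟨fun hh => ?_, fun hh => ?_⟩)
        · exact (inv_eq_iff_eq.1 hh.2).symm
        · have h3 : h⁻¹ b = x := by rw [inv_eq_iff_eq, hh]
          rw [Perm.mul_apply, Perm.mul_apply, h3, hx', hh]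
          exact ⟨rfl, rfl⟩
    rw [h2]
    push_cast
    rw [Finset.sum_mul, Finset.sum_congr rfl fun x _ =>
      (by exact_mod_cast card_perm_apply_eq_mul x b :
        ((Finset.univ.filter fun h : Perm α => h x = b).card : ℝ) * Fintype.card α =
          Fintype.card (Perm α))]
    simp
  have h3 := hρ.irr.card_mul_nchar h1 σ
  simp_rw [hF] at h3
  rw [Finset.sum_add_distrib, ← Finset.sum_filter, Finset.sum_const, Finset.sum_const,
    nsmul_eq_mul, nsmul_eq_mul, Finset.card_univ] at h3
  set m := (Finset.univ.filter fun h : Perm α => (h * σ * h⁻¹) b = b).card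
  have h4 : (m : ℝ) * (1 + 1 / (Fintype.card α - 1)) =
      (Finset.univ.filter fun x => σ x = x).card * Fintype.card (Perm α) /
        (Fintype.card α - 1) := by
    rw [← hcount]
    field_simp
    ring
  rw [h4] at h3
  refine mul_left_cancel₀ hfac ?_
  rw [h3]
  field_simp
  ring

theorem GoodRep.one_sub_nchar_le_pow (hρ : GoodRep ρ) {x y : α} (hxy : x ≠ y) (g : Perm α) :
    1 - nchar ρ g ≤ (2 ^ (g.support.card + 1) - 2) * (1 - nchar ρ (swap x y)) := by
  have := hρ.irr.1
  induction hs : g.support.card using Nat.strong_induction_on generalizing g with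
  | _ s ih =>
    by_cases hg : g = 1
    · subst hg
      rw [support_one, Finset.card_empty] at hs
      simp [nchar_one, ← hs]
    · obtain ⟨z, hz⟩ : ∃ z, g z ≠ z := by
        by_contra h
        push Not at h
        exact hg (Equiv.ext h)
      have h1 := card_support_swap_mul hz
      have h2 := ih _ (hs ▸ h1) (swap z (g z) * g) rfl
      have h3 := hρ.unitary.one_sub_nchar_mul_le (swap z (g z)) (swap z (g z) * g)
      rw [← mul_assoc, swap_mul_self, one_mul, nchar_swap_eq hxy (Ne.symm hz)] at h3
      have h4 : 0 ≤ 1 - nchar ρ (swap x y) := sub_nonneg.2 (hρ.unitary.nchar_le_one _)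
      have h5 : (2 : ℝ) ^ ((swap z (g z) * g).support.card + 1) ≤ 2 ^ s :=
        pow_le_pow_right₀ (by norm_num) (by omega)
      rw [pow_succ]
      nlinarith

theorem GoodRep.exists_fixedOff_compl (hρ : GoodRep ρ) {x y : α} (hxy : x ≠ y) (Z : Finset α)
    (hZ : (2 : ℝ) ^ (Z.card + 1) * (1 - nchar ρ (swap x y)) < 1) :
    ∃ v, v ≠ 0 ∧ FixedOff ρ Zᶜ v := by
  classical
  have := hρ.irr.1
  set H := Finset.univ.filter fun g : Perm α => ∀ b ∈ Zᶜ, g b = b with hH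
  set P := ∑ g ∈ H, ρ g with hP
  have hpos : 0 < (LinearMap.trace ℂ V P).re / Module.finrank ℂ V := by
    rw [hP, map_sum, Complex.re_sum, Finset.sum_div]
    refine Finset.sum_pos (fun g hg => ?_) ⟨1, by simp [hH]⟩
    have h1 := hρ.one_sub_nchar_le_pow hxy g
    have h2 : g.support.card ≤ Z.card := by
      refine Finset.card_le_card fun z hz => ?_
      by_contra h
      exact (mem_support.1 hz) ((Finset.mem_filter.1 hg).2 z (Finset.mem_compl.2 h))
    have h3 : (2 : ℝ) ^ (g.support.card + 1) ≤ 2 ^ (Z.card + 1) :=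
      pow_le_pow_right₀ (by norm_num) (by omega)
    have h4 : 0 ≤ 1 - nchar ρ (swap x y) := sub_nonneg.2 (hρ.unitary.nchar_le_one _)
    change 0 < nchar ρ g
    nlinarith
  have hP0 : P ≠ 0 := by
    rintro h
    simp [h] at hpos
  obtain ⟨w, hw⟩ : ∃ w, P w ≠ 0 := by
    by_contra h
    push Not at h
    exact hP0 (LinearMap.ext h)
  refine ⟨P w, hw, fun g hg => ?_⟩
  rw [hP, LinearMap.sum_apply, map_sum]
  refine Finset.sum_equiv (Equiv.mulLeft g) (fun h => ?_) fun h _ => ?_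
  · simp only [hH, Finset.mem_filter, Finset.mem_univ, true_and, coe_mulLeft, Perm.mul_apply]
    refine forall₂_congr fun b hb => ⟨fun h' => by rw [h', hg b hb], fun h' => ?_⟩
    exact g.injective (by rw [h', hg b hb])
  · rw [← Module.End.mul_apply, ← map_mul]
    rfl

end LowLevel

section CharacterEstimates

variable {α V : Type} [Fintype α] [DecidableEq α] [NormedAddCommGroup V] [InnerProductSpace ℂ V]

open Equiv Equiv.Perm

/-- The normalized character at permutations of cycle type `m` (zero if there are none). -/
noncomputable def classChar (ρ : Representation ℂ (Perm α) V) (m : Multiset ℕ) : ℝ :=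
  open Classical in if h : ∃ g : Perm α, g.cycleType = m then nchar ρ h.choose else 0

theorem nchar_eq_classChar (ρ : Representation ℂ (Perm α) V) {g : Perm α} {m : Multiset ℕ}
    (hg : g.cycleType = m) : nchar ρ g = classChar ρ m := by
  have h : ∃ g : Perm α, g.cycleType = m := ⟨g, hg⟩
  rw [classChar, dif_pos h]
  exact nchar_eq_of_isConj ρ (isConj_iff_cycleType_eq.2 (hg.trans h.choose_spec.symm))

theorem nchar_swap_eq_classChar (ρ : Representation ℂ (Perm α) V) {x y : α} (h : x ≠ y) :
    nchar ρ (swap x y) = classChar ρ {2} :=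
  nchar_eq_classChar ρ (isSwap_iff_cycleType.1 (swap_isSwap_iff.2 h))

variable {ρ : Representation ℂ (Perm α) V}

variable [FiniteDimensional ℂ V]

theorem IsUnitaryRep.trace_im_eq_zero (hρ : IsUnitaryRep ρ) (g : Perm α) :
    (LinearMap.trace ℂ V (ρ g)).im = 0 := by
  obtain ⟨c, hc⟩ := isConj_iff.1 (isConj_iff_cycleType_eq.2 (cycleType_inv g).symm)
  have h1 := hρ.trace_inv g
  rw [← hc, map_mul ρ, LinearMap.trace_mul_comm, ← map_mul ρ, ← mul_assoc, inv_mul_cancel,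
    one_mul] at h1
  exact Complex.conj_eq_iff_im.1 h1.symm

theorem card_filter_exists_mem_mul_le (S T : Finset α) :
    (Finset.univ.filter fun h : Perm α => ∃ x ∈ S, h x ∈ T).card * Fintype.card α ≤
      S.card * T.card * Fintype.card (Perm α) := by
  have hsub : (Finset.univ.filter fun h : Perm α => ∃ x ∈ S, h x ∈ T) ⊆
      (S ×ˢ T).biUnion fun p => Finset.univ.filter fun h : Perm α => h p.1 = p.2 := by
    intro h hh
    obtain ⟨x, hx, hy⟩ := (Finset.mem_filter.1 hh).2
    exact Finset.mem_biUnion.2 ⟨(x, h x), Finset.mk_mem_product hx hy, by simp⟩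
  refine (Nat.mul_le_mul_right _ ((Finset.card_le_card hsub).trans Finset.card_biUnion_le)).trans ?_
  rw [Finset.sum_mul, Finset.sum_congr rfl fun p _ => card_perm_apply_eq_mul p.1 p.2,
    Finset.sum_const, Finset.card_product, smul_eq_mul]

theorem GoodRep.abs_classChar_sq_sub_le (hρ : GoodRep ρ) {m : Multiset ℕ} {g g' : Perm α}
    (hd : Disjoint g g') (hg : g.cycleType = m) (hg' : g'.cycleType = m) :
    |classChar ρ m ^ 2 - classChar ρ (m + m)| * Fintype.card α ≤
      m.sum ^ 2 * (4 * (1 - classChar ρ m)) := by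
  have := hρ.irr.1
  have hfac : (0 : ℝ) < Fintype.card (Perm α) := by exact_mod_cast Fintype.card_pos
  have h1 : ∀ u : Perm α, u.cycleType = m → nchar ρ u = classChar ρ m :=
    fun u hu => nchar_eq_classChar ρ hu
  have h2 : nchar ρ (g * g') = classChar ρ (m + m) :=
    nchar_eq_classChar ρ (by rw [hd.cycleType_mul, hg, hg'])
  have hψ : 0 ≤ 1 - classChar ρ m := by
    rw [← h1 g hg]
    exact sub_nonneg.2 (hρ.unitary.nchar_le_one g)
  have hterm : ∀ h : Perm α, |nchar ρ (g * (h * g' * h⁻¹)) - classChar ρ (m + m)| ≤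
      if ∃ x ∈ g'.support, h x ∈ g.support then 4 * (1 - classChar ρ m) else 0 := by
    intro h
    split_ifs with hh
    · have h3 := hρ.unitary.one_sub_nchar_mul_le g g'
      have h4 := hρ.unitary.one_sub_nchar_mul_le g (h * g' * h⁻¹)
      have h5 := hρ.unitary.nchar_le_one (g * (h * g' * h⁻¹))
      have h6 := hρ.unitary.nchar_le_one (g * g')
      rw [nchar_conj, h1 g hg, h1 g' hg'] at h4
      rw [h1 g hg, h1 g' hg'] at h3
      rw [← h2, abs_le]
      constructor <;> linarith
    · have hdis : Disjoint g (h * g' * h⁻¹) := by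
        intro x
        by_contra hx
        push Not at hx
        have hinv : h (h⁻¹ x) = x := h.apply_symm_apply x
        refine hh ⟨h⁻¹ x, mem_support.2 fun h3 => hx.2 ?_, ?_⟩
        · rw [Perm.mul_apply, Perm.mul_apply, h3, hinv]
        · rw [hinv]
          exact mem_support.2 hx.1
      rw [nchar_eq_classChar ρ (m := m + m), sub_self, abs_zero]
      rw [hdis.cycleType_mul, cycleType_conj, hg, hg']
  have hsum := hρ.irr.card_mul_nchar_mul g g' (hρ.unitary.trace_im_eq_zero g')
  rw [h1 g hg, h1 g' hg'] at hsum
  have hle : (Fintype.card (Perm α) : ℝ) * |classChar ρ m ^ 2 - classChar ρ (m + m)| ≤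
      (Finset.univ.filter fun h : Perm α => ∃ x ∈ g'.support, h x ∈ g.support).card *
        (4 * (1 - classChar ρ m)) := by
    have h3 : (Fintype.card (Perm α) : ℝ) * (classChar ρ m ^ 2 - classChar ρ (m + m)) =
        ∑ h, (nchar ρ (g * (h * g' * h⁻¹)) - classChar ρ (m + m)) := by
      rw [Finset.sum_sub_distrib, ← hsum]
      simp
      ring
    have h4 : (Fintype.card (Perm α) : ℝ) * |classChar ρ m ^ 2 - classChar ρ (m + m)| =
        |Fintype.card (Perm α) * (classChar ρ m ^ 2 - classChar ρ (m + m))| := by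
      rw [abs_mul, Nat.abs_cast]
    rw [h4, h3]
    refine (Finset.abs_sum_le_sum_abs _ _).trans
      ((Finset.sum_le_sum fun h _ => hterm h).trans_eq ?_)
    rw [← Finset.sum_filter, Finset.sum_const, nsmul_eq_mul]
  have hcnt := card_filter_exists_mem_mul_le g'.support g.support
  rw [← sum_cycleType, ← sum_cycleType, hg, hg'] at hcnt
  have hcnt' : ((Finset.univ.filter fun h : Perm α =>
      ∃ x ∈ g'.support, h x ∈ g.support).card : ℝ) * Fintype.card α ≤
        m.sum * m.sum * Fintype.card (Perm α) := by exact_mod_cast hcnt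
  refine le_of_mul_le_mul_left ?_ hfac
  calc (Fintype.card (Perm α) : ℝ) *
        (|classChar ρ m ^ 2 - classChar ρ (m + m)| * Fintype.card α)
      = (Fintype.card (Perm α) * |classChar ρ m ^ 2 - classChar ρ (m + m)|) *
          Fintype.card α := by ring
    _ ≤ ((Finset.univ.filter fun h : Perm α => ∃ x ∈ g'.support, h x ∈ g.support).card *
        (4 * (1 - classChar ρ m))) * Fintype.card α :=
        mul_le_mul_of_nonneg_right hle (Nat.cast_nonneg _)
    _ = ((Finset.univ.filter fun h : Perm α => ∃ x ∈ g'.support, h x ∈ g.support).card *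
        Fintype.card α) * (4 * (1 - classChar ρ m)) := by ring
    _ ≤ (m.sum * m.sum * Fintype.card (Perm α)) * (4 * (1 - classChar ρ m)) :=
        mul_le_mul_of_nonneg_right hcnt' (by positivity)
    _ = Fintype.card (Perm α) * (m.sum ^ 2 * (4 * (1 - classChar ρ m))) := by ring

theorem GoodRep.classChar_estimates (hρ : GoodRep ρ) (hn : 8 ≤ Fintype.card α) :
    |classChar ρ {2} ^ 2 - classChar ρ {2, 2}| * Fintype.card α ≤ 16 * (1 - classChar ρ {2}) ∧
    |classChar ρ {2, 2} ^ 2 - classChar ρ {2, 2, 2, 2}| * Fintype.card α ≤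
      64 * (1 - classChar ρ {2, 2}) ∧
    1 - classChar ρ {2, 2, 2, 2} ≤ 4 * (1 - classChar ρ {2, 2}) ∧
    classChar ρ {2} ≤ 1 ∧ -1 ≤ classChar ρ {2} ∧ classChar ρ {2, 2} ≤ 1 := by
  have := hρ.irr.1
  obtain ⟨f⟩ : Nonempty (Fin 8 ↪ α) :=
    Function.Embedding.nonempty_of_card_le (by simpa using hn)
  have hf : ∀ i j, f i = f j ↔ i = j := fun i j => f.injective.eq_iff
  have t : ∀ i j, i ≠ j → (swap (f i) (f j)).cycleType = {2} := fun i j h =>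
    isSwap_iff_cycleType.1 (swap_isSwap_iff.2 (f.injective.ne h))
  have d : ∀ i j k l, [i, j, k, l].Nodup →
      Disjoint (swap (f i) (f j)) (swap (f k) (f l)) := fun i j k l h =>
    disjoint_swap_swap (by simpa [hf] using h)
  have a := d 0 1 2 3 (by decide)
  have b := d 4 5 6 7 (by decide)
  have ab : Disjoint (swap (f 0) (f 1) * swap (f 2) (f 3))
      (swap (f 4) (f 5) * swap (f 6) (f 7)) :=
    Disjoint.mul_left ((d 0 1 4 5 (by decide)).mul_right (d 0 1 6 7 (by decide)))
      ((d 2 3 4 5 (by decide)).mul_right (d 2 3 6 7 (by decide)))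
  have ta : (swap (f 0) (f 1) * swap (f 2) (f 3)).cycleType = {2, 2} := by
    rw [a.cycleType_mul, t _ _ (by decide), t _ _ (by decide)]
    rfl
  have tb : (swap (f 4) (f 5) * swap (f 6) (f 7)).cycleType = {2, 2} := by
    rw [b.cycleType_mul, t _ _ (by decide), t _ _ (by decide)]
    rfl
  have h1 := hρ.abs_classChar_sq_sub_le a (t _ _ (by decide)) (t _ _ (by decide))
  have h2 := hρ.abs_classChar_sq_sub_le ab ta tb
  have h3 := hρ.unitary.one_sub_nchar_mul_le (swap (f 0) (f 1) * swap (f 2) (f 3))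
    (swap (f 4) (f 5) * swap (f 6) (f 7))
  have h4 := hρ.unitary.nchar_le_one (swap (f 0) (f 1))
  have h5 := hρ.unitary.neg_one_le_nchar (swap (f 0) (f 1))
  have h6 := hρ.unitary.nchar_le_one (swap (f 0) (f 1) * swap (f 2) (f 3))
  rw [nchar_eq_classChar ρ ta, nchar_eq_classChar ρ tb,
    nchar_eq_classChar ρ (ab.cycleType_mul.trans (congrArg₂ _ ta tb))] at h3
  rw [nchar_eq_classChar ρ (t 0 1 (by decide))] at h4 h5
  rw [nchar_eq_classChar ρ ta] at h6
  have e1 : ({2} + {2} : Multiset ℕ) = {2, 2} := rfl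
  have e2 : ({2, 2} + {2, 2} : Multiset ℕ) = {2, 2, 2, 2} := rfl
  rw [e1] at h1
  rw [e2] at h2 h3
  have s1 : ({2} : Multiset ℕ).sum = 2 := rfl
  have s2 : ({2, 2} : Multiset ℕ).sum = 4 := rfl
  rw [s1] at h1
  rw [s2] at h2
  push_cast at h1 h2
  exact ⟨by linarith, by linarith, by linarith, h4, h5, h6⟩

omit [Fintype α] [DecidableEq α] in
/-- Almost orthogonality of the translates of a vector by the `g i` forces a small overlap. -/
theorem IsUnitaryRep.sq_nchar_mul_le {G : Type} [Group G] [Nontrivial V]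
    {ρ : Representation ℂ G V} (hρ : IsUnitaryRep ρ) {j : ℕ} (hj : 0 < j) (g : Fin j → G) (σ : G)
    {D Q x : ℝ} (hD : ∀ i, nchar ρ (g i) = D)
    (hQ : ∀ i k, i ≠ k → nchar ρ ((g i)⁻¹ * g k) = Q) (hx : nchar ρ σ = x)
    (hgx : ∀ i, nchar ρ ((g i)⁻¹ * σ) = x) :
    x ^ 2 * (1 - D) ^ 2 ≤ (1 - Q) / j + (Q - D ^ 2) := by
  have hj' : (j : ℝ) ≠ 0 := by exact_mod_cast hj.ne'
  have hgx' : ∀ i, nchar ρ (σ⁻¹ * g i) = x := fun i => by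
    rw [← hgx i, ← hρ.nchar_inv (σ⁻¹ * g i), mul_inv_rev, inv_inv]
  have hgg : ∀ i, ∑ k, nchar ρ ((g i)⁻¹ * g k) = 1 + (j - 1) * Q := fun i => by
    rw [← Finset.add_sum_erase _ _ (Finset.mem_univ i),
      Finset.sum_congr rfl fun k hk => hQ i k (Finset.ne_of_mem_erase hk).symm]
    rw [inv_mul_cancel, nchar_one, Finset.sum_const,
      Finset.card_erase_of_mem (Finset.mem_univ i), Finset.card_univ, Fintype.card_fin,
      nsmul_eq_mul, Nat.cast_sub hj, Nat.cast_one]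
  have h := hρ.nchar_posDef (ι := Option (Option (Fin j)))
    (fun o => o.elim (-(x * (1 - D))) fun o => o.elim (-D) fun _ => 1 / j)
    (fun o => o.elim σ fun o => o.elim 1 g)
  simp only [Fintype.sum_option, Option.elim_none, Option.elim_some, inv_mul_cancel, nchar_one,
    inv_one, one_mul, mul_one, hρ.nchar_inv, hx, hD, hgx, hgx', Finset.sum_const,
    Finset.card_univ, Fintype.card_fin, nsmul_eq_mul, Finset.sum_add_distrib,
    ← Finset.mul_sum, hgg] at h
  field_simp at h ⊢
  linarith

omit [FiniteDimensional ℂ V] in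
theorem exists_embedding_of_derangement {σ : Perm α} (hσ : ∀ x, σ x ≠ x) {j : ℕ}
    (hj : 6 * j ≤ Fintype.card α) :
    ∃ e : Fin j × Fin 2 ↪ α, ∀ p q, σ (e p) ≠ e q := by
  have key : ∀ m : ℕ, 3 * m ≤ Fintype.card α →
      ∃ X : Finset α, X.card = m ∧ ∀ x ∈ X, ∀ y ∈ X, σ x ≠ y := by
    intro m
    induction m with
    | zero => exact fun _ => ⟨∅, rfl, by simp⟩
    | succ m ih =>
      intro hm
      obtain ⟨X, hX, hd⟩ := ih (by omega)
      have hlt : (X ∪ X.image σ ∪ X.image σ.symm).card < (Finset.univ : Finset α).card := by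
        have h1 := Finset.card_union_le (X ∪ X.image σ) (X.image σ.symm)
        have h2 := Finset.card_union_le X (X.image σ)
        have h3 := Finset.card_image_le (s := X) (f := σ)
        have h4 := Finset.card_image_le (s := X) (f := σ.symm)
        rw [Finset.card_univ]
        omega
      obtain ⟨z, -, hz⟩ := Finset.exists_mem_notMem_of_card_lt_card hlt
      simp only [Finset.mem_union, not_or, Finset.mem_image, not_exists, not_and] at hz
      refine ⟨insert z X, by rw [Finset.card_insert_of_notMem hz.1.1, hX], ?_⟩
      intro x hx y hy
      rw [Finset.mem_insert] at hx hy
      rcases hx with rfl | hx <;> rcases hy with rfl | hy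
      · exact hσ _
      · exact fun h => hz.2 y hy (by rw [← h, symm_apply_apply])
      · exact hz.1.2 x hx
      · exact hd x hx y hy
  obtain ⟨X, hX, hd⟩ := key (j * 2) (by omega)
  let e : Fin j × Fin 2 ≃ X := finProdFinEquiv.trans (X.equivFinOfCardEq hX).symm
  exact ⟨e.toEmbedding.trans (Function.Embedding.subtype _),
    fun p q => hd _ (e p).2 _ (e q).2⟩

theorem GoodRep.sq_nchar_mul_le_of_derangement (hρ : GoodRep ρ) (hn : 8 ≤ Fintype.card α)
    {σ : Perm α} (hσ : ∀ x, σ x ≠ x) :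
    nchar ρ σ ^ 2 * (1 - classChar ρ {2, 2}) ^ 2 * Fintype.card α ≤
      112 * (1 - classChar ρ {2, 2}) := by
  have := hρ.irr.1
  obtain ⟨-, hDQ, hQ, -, -, hD⟩ := hρ.classChar_estimates hn
  obtain ⟨j, hjdef⟩ : ∃ j, j = Fintype.card α / 6 := ⟨_, rfl⟩
  obtain ⟨e, he⟩ := exists_embedding_of_derangement hσ (j := j) (by omega)
  have hj : 0 < j := by omega
  have hj12 : (Fintype.card α : ℝ) ≤ 12 * j := by
    exact_mod_cast (by omega : Fintype.card α ≤ 12 * j)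
  have hne : ∀ p q, p ≠ q → e p ≠ e q := fun p q h => e.injective.ne h
  have hne' : ∀ p q, p ≠ q → σ (e p) ≠ σ (e q) := fun p q h => σ.injective.ne (hne p q h)
  have hdis : ∀ p q r s : Fin j × Fin 2, p ≠ q → r ≠ s → p ≠ r → p ≠ s → q ≠ r → q ≠ s →
      Disjoint (swap (e p) (e q)) (swap (e r) (e s)) := fun p q r s h1 h2 h3 h4 h5 h6 =>
    disjoint_swap_swap (by
      simp [hne _ _ h1, hne _ _ h2, hne _ _ h3, hne _ _ h4, hne _ _ h5, hne _ _ h6])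
  have hdis1 : ∀ p q r s : Fin j × Fin 2, p ≠ q → r ≠ s →
      Disjoint (swap (σ (e p)) (σ (e q))) (swap (e r) (e s)) := fun p q r s h1 h2 =>
    disjoint_swap_swap (by simp [hne _ _ h1, hne _ _ h2, he])
  let τ : Fin j → Perm α := fun i => swap (e (i, 0)) (e (i, 1))
  have hτ : ∀ i, σ * τ i * σ⁻¹ = swap (σ (e (i, 0))) (σ (e (i, 1))) := fun i =>
    (swap_apply_apply σ _ _).symm
  have h01 : ∀ i i' : Fin j, ((i, 0) : Fin j × Fin 2) ≠ (i', 1) := fun i i' h => by simp at h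
  have hττ : ∀ i k, i ≠ k → Disjoint (τ i) (τ k) := fun i k hik =>
    hdis _ _ _ _ (h01 _ _) (h01 _ _) (by simpa using hik) (h01 _ _) (h01 _ _).symm
      (by simpa using hik)
  have hστ : ∀ i k, Disjoint (σ * τ i * σ⁻¹) (τ k) := fun i k => by
    rw [hτ]
    exact hdis1 _ _ _ _ (h01 _ _) (h01 _ _)
  have htype : ∀ i, (σ * τ i * σ⁻¹ * τ i).cycleType = {2, 2} := fun i => by
    have h2 : (τ i).cycleType = {2} :=
      isSwap_iff_cycleType.1 (swap_isSwap_iff.2 (hne _ _ (h01 i i)))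
    rw [(hστ i i).cycleType_mul, cycleType_conj, h2]
    rfl
  have hgg : ∀ i k, i ≠ k → Disjoint (σ * τ i * σ⁻¹ * τ i) (σ * τ k * σ⁻¹ * τ k) :=
    fun i k hik => Disjoint.mul_left
      (Disjoint.mul_right ((hττ i k hik).conj σ) (hστ i k))
      (Disjoint.mul_right (hστ k i).symm (hττ i k hik))
  have key := hρ.unitary.sq_nchar_mul_le hj (fun i => σ * τ i * σ⁻¹ * τ i) σ
    (fun i => nchar_eq_classChar ρ (htype i))
    (fun i k hik => nchar_eq_classChar ρ (m := {2, 2, 2, 2}) (by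
      rw [(hgg i k hik).inv_left.cycleType_mul, cycleType_inv, htype, htype]
      rfl)) rfl
    (fun i => by
      have h1 : (σ * τ i * σ⁻¹ * τ i)⁻¹ * σ = (τ i)⁻¹ * σ * (τ i)⁻¹⁻¹ := by
        have : (τ i)⁻¹ = τ i := swap_inv _ _
        rw [mul_inv_rev, mul_inv_rev, mul_inv_rev, inv_inv, inv_inv, this]
        group
      rw [h1, nchar_conj])
  have hn0 : (0 : ℝ) < Fintype.card α := by exact_mod_cast (by omega : 0 < Fintype.card α)
  have h1 : (1 - classChar ρ {2, 2, 2, 2}) / j * Fintype.card α ≤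
      48 * (1 - classChar ρ {2, 2}) := by
    have hj0 : (0 : ℝ) < j := by exact_mod_cast hj
    rw [div_mul_eq_mul_div, div_le_iff₀ hj0]
    nlinarith
  have h2 : (classChar ρ {2, 2, 2, 2} - classChar ρ {2, 2} ^ 2) * Fintype.card α ≤
      64 * (1 - classChar ρ {2, 2}) := by
    refine le_trans (mul_le_mul_of_nonneg_right ?_ hn0.le) hDQ
    rw [abs_sub_comm]
    exact le_abs_self _
  have h3 := mul_le_mul_of_nonneg_right key hn0.le
  rw [add_mul] at h3
  linarith

end CharacterEstimates

section Derangements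

variable {α V : Type} [Fintype α] [DecidableEq α] [NormedAddCommGroup V] [InnerProductSpace ℂ V]

open Equiv Equiv.Perm

/-- The tensor product with the sign character. -/
noncomputable def sgnTwist (ρ : Representation ℂ (Perm α) V) : Representation ℂ (Perm α) V where
  toFun g := ((sign g : ℤ) : ℂ) • ρ g
  map_one' := by simp
  map_mul' g h := by
    rw [map_mul, map_mul, smul_mul_smul_comm]
    push_cast
    rfl

theorem sgnTwist_apply (ρ : Representation ℂ (Perm α) V) (g : Perm α) (v : V) :
    sgnTwist ρ g v = ((sign g : ℤ) : ℂ) • ρ g v := rfl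

theorem nchar_sgnTwist (ρ : Representation ℂ (Perm α) V) (g : Perm α) :
    nchar (sgnTwist ρ) g = (sign g : ℤ) * nchar ρ g := by
  have h : sgnTwist ρ g = ((sign g : ℤ) : ℂ) • ρ g := rfl
  unfold nchar
  rw [h, map_smul, smul_eq_mul]
  rcases Int.units_eq_one_or (sign g) with h | h <;> simp [h, neg_div]

theorem abs_nchar_sgnTwist (ρ : Representation ℂ (Perm α) V) (g : Perm α) :
    |nchar (sgnTwist ρ) g| = |nchar ρ g| := by
  rw [nchar_sgnTwist]
  rcases Int.units_eq_one_or (sign g) with h | h <;> simp [h]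

theorem sign_smul_sign_smul (g : Perm α) (v : V) :
    ((sign g : ℤ) : ℂ) • ((sign g : ℤ) : ℂ) • v = v := by
  rcases Int.units_eq_one_or (sign g) with h | h <;> simp [h]

variable {ρ : Representation ℂ (Perm α) V}

theorem GoodRep.sgnTwist (hρ : GoodRep ρ) : GoodRep (sgnTwist ρ) where
  unitary g v w := by
    rw [sgnTwist_apply, sgnTwist_apply, ← hρ.unitary g v w]
    rcases Int.units_eq_one_or (sign g) with h | h <;> simp [h]
  irr := by
    refine ⟨hρ.irr.1, fun p hp => hρ.irr.2 p fun g v hv => ?_⟩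
    have h := p.smul_mem ((sign g : ℤ) : ℂ) (hp g v hv)
    rwa [sgnTwist_apply, sign_smul_sign_smul] at h
  no_inv v hv := hρ.no_sgn v fun g => by
    conv_rhs => rw [← hv g, sgnTwist_apply, sign_smul_sign_smul]
  no_sgn v hv := hρ.no_inv v fun g => by
    have h := hv g
    rw [sgnTwist_apply] at h
    rw [← sign_smul_sign_smul g (ρ g v), h, sign_smul_sign_smul]

theorem classChar_sgnTwist (hn : 8 ≤ Fintype.card α) :
    classChar (sgnTwist ρ) {2} = -classChar ρ {2} ∧
      classChar (sgnTwist ρ) {2, 2} = classChar ρ {2, 2} := by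
  obtain ⟨f⟩ : Nonempty (Fin 8 ↪ α) :=
    Function.Embedding.nonempty_of_card_le (by simpa using hn)
  have h01 : f 0 ≠ f 1 := f.injective.ne (by decide)
  have h23 : f 2 ≠ f 3 := f.injective.ne (by decide)
  have h4 : (swap (f 0) (f 1) * swap (f 2) (f 3)).cycleType = {2, 2} :=
    cycleType_swap_mul_swap_of_nodup (by simp [f.injective.eq_iff])
  constructor
  · rw [← nchar_swap_eq_classChar _ h01, ← nchar_swap_eq_classChar _ h01, nchar_sgnTwist,
      sign_swap h01]
    simp
  · rw [← nchar_eq_classChar _ h4, ← nchar_eq_classChar _ h4, nchar_sgnTwist, Perm.sign_mul,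
      sign_swap h01, sign_swap h23]
    simp

/-- Up to a twist by the sign, transpositions have nonnegative trace. -/
theorem GoodRep.of_nonneg_classChar {P : Representation ℂ (Perm α) V → Prop}
    (hn : 8 ≤ Fintype.card α) (htwist : ∀ ρ, P (_root_.sgnTwist ρ) → P ρ)
    (h : ∀ ρ, GoodRep ρ → 0 ≤ classChar ρ {2} → P ρ) (hρ : GoodRep ρ) : P ρ := by
  rcases le_total 0 (classChar ρ {2}) with h0 | h0
  · exact h ρ hρ h0
  · refine htwist ρ (h _ hρ.sgnTwist ?_)
    rw [(classChar_sgnTwist hn).1]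
    linarith

variable [FiniteDimensional ℂ V]

theorem GoodRep.one_le_card_mul_one_sub (hρ : GoodRep ρ) (hn : 32 ≤ Fintype.card α) :
    1 ≤ Fintype.card α * (1 - classChar ρ {2, 2}) := by
  refine GoodRep.of_nonneg_classChar (P := fun ρ => 1 ≤ Fintype.card α *
    (1 - classChar ρ {2, 2})) (by omega) (fun ρ h => ?_) (fun ρ hρ h0 => ?_) hρ
  · rwa [(classChar_sgnTwist (by omega)).2] at h
  have := hρ.irr.1
  obtain ⟨hr, -, -, h1, -, -⟩ := hρ.classChar_estimates (by omega)
  obtain ⟨B, v, hv1, hv, hB, hmin⟩ := hρ.exists_minimal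
  obtain ⟨x, y, hxy⟩ := Fintype.one_lt_card_iff.1 (by omega : 1 < Fintype.card α)
  have h2 := hρ.le_one_sub_nchar_swap hv hv1 hmin hxy
  have h3 : (B.card : ℝ) + 1 ≤ Fintype.card α := by
    exact_mod_cast card_le_of_minimal hmin x
  have h4 : (1 : ℝ) ≤ B.card := by exact_mod_cast hB
  have h5 : (32 : ℝ) ≤ Fintype.card α := by exact_mod_cast hn
  rw [nchar_swap_eq_classChar ρ hxy] at h2
  have h6 : 2 ≤ (Fintype.card α - 1) * (1 - classChar ρ {2}) := by
    have : (Fintype.card α : ℝ) * 2 ≤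
        Fintype.card α * ((Fintype.card α - 1) * (1 - classChar ρ {2})) := by nlinarith
    exact le_of_mul_le_mul_left this (by linarith)
  have h7 : (classChar ρ {2, 2} - classChar ρ {2} ^ 2) * Fintype.card α ≤
      16 * (1 - classChar ρ {2}) := by
    refine le_trans (mul_le_mul_of_nonneg_right ?_ (by linarith)) hr
    rw [abs_sub_comm]
    exact le_abs_self _
  nlinarith

theorem GoodRep.abs_nchar_le_of_small (hρ : GoodRep ρ) (h0 : 0 ≤ classChar ρ {2})
    {A : ℝ} (hA : 0 < A) {M : ℕ} (hM : A + 16 < M) (hn8 : 8 ≤ Fintype.card α)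
    (hnM : M ≤ Fintype.card α) (hn2 : (2 : ℝ) ^ (M + 1) * (A + 16) < Fintype.card α)
    (hnA : 4 * (A + 16) ≤ Fintype.card α)
    (hD : Fintype.card α * (1 - classChar ρ {2, 2}) < A) {σ : Perm α} (hσ : ∀ x, σ x ≠ x) :
    |nchar ρ σ| ≤ 4 * (A + 16) / Fintype.card α := by
  have := hρ.irr.1
  obtain ⟨hr, -, -, h1, -, -⟩ := hρ.classChar_estimates hn8
  obtain ⟨B, v, hv1, hv, hB, hmin⟩ := hρ.exists_minimal
  obtain ⟨x, y, hxy⟩ := Fintype.one_lt_card_iff.1 (by omega : 1 < Fintype.card α)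
  have h2 := hρ.le_one_sub_nchar_swap hv hv1 hmin hxy
  have hn : (8 : ℝ) ≤ Fintype.card α := by exact_mod_cast hn8
  have h7 : (classChar ρ {2, 2} - classChar ρ {2} ^ 2) * Fintype.card α ≤
      16 * (1 - classChar ρ {2}) := by
    refine le_trans (mul_le_mul_of_nonneg_right ?_ (by linarith)) hr
    rw [abs_sub_comm]
    exact le_abs_self _
  have hsmall : Fintype.card α * (1 - classChar ρ {2}) ≤ A + 16 := by
    have h8 : 1 - classChar ρ {2} ≤ 1 - classChar ρ {2} ^ 2 := by nlinarith
    nlinarith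
  obtain ⟨Z, -, hZ⟩ := Finset.exists_subset_card_eq (s := (Finset.univ : Finset α)) (n := M)
    (by simpa using hnM)
  obtain ⟨w, hw0, hw⟩ := hρ.exists_fixedOff_compl hxy Z (by
    rw [hZ, nchar_swap_eq_classChar ρ hxy]
    have h9 : (0 : ℝ) < 2 ^ (M + 1) := by positivity
    have h10 : (2 : ℝ) ^ (M + 1) * (Fintype.card α * (1 - classChar ρ {2})) ≤
        2 ^ (M + 1) * (A + 16) := mul_le_mul_of_nonneg_left hsmall h9.le
    nlinarith)
  have hk : (B.card : ℝ) + M ≤ Fintype.card α := by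
    have h11 : B.card ≤ Zᶜ.card := by
      by_contra h
      exact hw0 (hmin _ (not_le.1 h) w hw)
    rw [Finset.card_compl, hZ] at h11
    exact_mod_cast (by omega : B.card + M ≤ Fintype.card α)
  have hkpos : (1 : ℝ) ≤ B.card := by exact_mod_cast hB
  rw [nchar_swap_eq_classChar ρ hxy] at h2
  have h12 : 2 * (B.card : ℝ) * (Fintype.card α - B.card) ≤ Fintype.card α * (A + 16) := by
    nlinarith
  have h13 : 2 * (B.card : ℝ) < Fintype.card α := by
    by_contra h
    nlinarith
  have h14 : (B.card : ℝ) ≤ A + 16 := by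
    have : (Fintype.card α : ℝ) * B.card ≤ Fintype.card α * (A + 16) := by nlinarith
    exact le_of_mul_le_mul_left this (by linarith)
  refine (hρ.abs_nchar_le_of_derangement hv hv1 hB hmin (by exact_mod_cast h13.le) hσ).trans ?_
  have h15 : (B.card : ℝ) / (Fintype.card α - 1) ≤ (A + 16) / (Fintype.card α / 2) :=
    div_le_div₀ (by linarith) h14 (by linarith) (by linarith)
  have h16 : (B.card : ℝ) / (Fintype.card α - 2 * B.card + 1) ≤
      (A + 16) / (Fintype.card α / 2) :=
    div_le_div₀ (by linarith) h14 (by linarith) (by linarith)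
  refine (add_le_add h15 h16).trans_eq ?_
  field_simp
  ring

end Derangements

section Uniform

open Equiv Equiv.Perm

/-- Normalized characters are uniformly small at derangements. -/
theorem exists_forall_abs_nchar_le {ε : ℝ} (hε : 0 < ε) : ∃ N : ℕ, 32 ≤ N ∧
    ∀ (α V : Type) [Fintype α] [DecidableEq α] [NormedAddCommGroup V] [InnerProductSpace ℂ V]
      [FiniteDimensional ℂ V] (ρ : Representation ℂ (Perm α) V), N ≤ Fintype.card α →
      GoodRep ρ → ∀ σ : Perm α, (∀ x, σ x ≠ x) → |nchar ρ σ| ≤ ε := by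
  set A : ℝ := 112 / ε ^ 2 with hAdef
  have hA : 0 < A := by positivity
  obtain ⟨M, hM⟩ := exists_nat_gt (A + 16)
  obtain ⟨N₁, hN₁⟩ := exists_nat_gt ((2 : ℝ) ^ (M + 1) * (A + 16))
  obtain ⟨N₂, hN₂⟩ := exists_nat_ge (4 * (A + 16))
  obtain ⟨N₃, hN₃⟩ := exists_nat_ge (4 * (A + 16) / ε)
  refine ⟨32 + M + N₁ + N₂ + N₃, by omega, fun α V _ _ _ _ _ ρ hn hρ σ hσ => ?_⟩
  have h1 : (N₁ : ℝ) ≤ Fintype.card α := by exact_mod_cast (by omega : N₁ ≤ Fintype.card α)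
  have h2 : (N₂ : ℝ) ≤ Fintype.card α := by exact_mod_cast (by omega : N₂ ≤ Fintype.card α)
  have h3 : (N₃ : ℝ) ≤ Fintype.card α := by exact_mod_cast (by omega : N₃ ≤ Fintype.card α)
  have hn0 : (32 : ℝ) ≤ Fintype.card α := by exact_mod_cast (by omega : 32 ≤ Fintype.card α)
  rcases lt_or_ge ((Fintype.card α : ℝ) * (1 - classChar ρ {2, 2})) A with hD | hD
  · have h4 : 4 * (A + 16) / Fintype.card α ≤ ε := by
      rw [div_le_iff₀ (by linarith)]
      rw [div_le_iff₀ hε] at hN₃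
      nlinarith
    refine le_trans ?_ h4
    refine GoodRep.of_nonneg_classChar (P := fun ρ => Fintype.card α *
      (1 - classChar ρ {2, 2}) < A → |nchar ρ σ| ≤ 4 * (A + 16) / Fintype.card α)
      (by omega) (fun ρ h => ?_) (fun ρ hρ h0 hD => ?_) hρ hD
    · rwa [(classChar_sgnTwist (by omega)).2, abs_nchar_sgnTwist] at h
    · exact hρ.abs_nchar_le_of_small h0 hA hM (by omega) (by omega) (by linarith) (by linarith)
        hD hσ
  · have h4 := hρ.sq_nchar_mul_le_of_derangement (by omega) hσ
    have hpos : 0 < 1 - classChar ρ {2, 2} := by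
      by_contra h
      nlinarith
    have h5 : nchar ρ σ ^ 2 * (Fintype.card α * (1 - classChar ρ {2, 2})) ≤ 112 := by
      refine le_of_mul_le_mul_right ?_ hpos
      linarith
    have h6 : nchar ρ σ ^ 2 * A ≤ 112 :=
      (mul_le_mul_of_nonneg_left hD (sq_nonneg _)).trans h5
    refine abs_le_of_sq_le_sq (le_of_mul_le_mul_right (h6.trans_eq ?_) hA) hε.le
    rw [hAdef]
    field_simp

variable {α V : Type} [Fintype α] [DecidableEq α] [NormedAddCommGroup V] [InnerProductSpace ℂ V]
  [FiniteDimensional ℂ V] {ρ : Representation ℂ (Perm α) V}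

theorem GoodRep.one_sub_nchar_commutator_le (hρ : GoodRep ρ) (σ : Perm α) (x z : α) :
    1 - nchar ρ (swap (σ x) (σ z) * swap x z) ≤ 4 * (1 - nchar ρ σ) := by
  have := hρ.irr.1
  have h := hρ.unitary.one_sub_nchar_mul_le σ (swap x z * σ⁻¹ * (swap x z)⁻¹)
  rw [nchar_conj, hρ.unitary.nchar_inv] at h
  have h2 : swap (σ x) (σ z) * swap x z = σ * (swap x z * σ⁻¹ * (swap x z)⁻¹) := by
    rw [swap_apply_apply, swap_inv]
    group
  rw [h2]
  linarith

theorem GoodRep.one_sub_classChar_le (hρ : GoodRep ρ) (hn : 5 ≤ Fintype.card α) {σ : Perm α}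
    (hσ : σ ≠ 1) : 1 - classChar ρ {2, 2} ≤ 16 * (1 - nchar ρ σ) := by
  have := hρ.irr.1
  have hψ : 0 ≤ 1 - nchar ρ σ := sub_nonneg.2 (hρ.unitary.nchar_le_one σ)
  obtain ⟨x, hx⟩ : ∃ x, σ x ≠ x := by
    by_contra h
    push Not at h
    exact hσ (Equiv.ext h)
  by_cases hc : ∃ z, z ≠ x ∧ z ≠ σ x ∧ σ z ≠ x ∧ σ z ≠ z
  · obtain ⟨z, hzx, hzy, hzx', hz⟩ := hc
    have h := hρ.one_sub_nchar_commutator_le σ x z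
    have hne : σ x ≠ σ z := σ.injective.ne hzx.symm
    rw [nchar_eq_classChar ρ (m := {2, 2}) (cycleType_swap_mul_swap_of_nodup (by
      simp [hne, hx, hzy.symm, hzx', hz, hzx.symm]))] at h
    linarith
  · push Not at hc
    have hcard : 1 < (({x, σ x, σ.symm x} : Finset α)ᶜ).card := by
      rw [Finset.card_compl]
      have := Finset.card_le_three (a := x) (b := σ x) (c := σ.symm x)
      omega
    obtain ⟨z, hz, w, hw, hzw⟩ := Finset.one_lt_card.1 hcard
    simp only [Finset.mem_compl, Finset.mem_insert, Finset.mem_singleton, not_or] at hz hw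
    have hσz : σ z = z := hc z hz.1 hz.2.1 fun h => hz.2.2 (by rw [← h, symm_apply_apply])
    have h := hρ.one_sub_nchar_commutator_le σ x z
    rw [hσz, swap_comm (σ x) z, swap_comm x z] at h
    have h3 : (swap z (σ x) * swap z x).IsThreeCycle :=
      isThreeCycle_swap_mul_swap_same hz.2.1 hz.1 hx
    have h3' : (swap x z * swap x w).IsThreeCycle :=
      isThreeCycle_swap_mul_swap_same (Ne.symm hz.1) (Ne.symm hw.1) hzw
    have h4 := hρ.unitary.one_sub_nchar_mul_le (swap z (σ x) * swap z x) (swap x z * swap x w)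
    have h5 : swap z (σ x) * swap z x * (swap x z * swap x w) =
        swap z (σ x) * swap x w := by
      rw [swap_comm z x, mul_assoc, ← mul_assoc (swap x z), swap_mul_self, one_mul]
    rw [h5, nchar_eq_classChar ρ (m := {2, 2}) (cycleType_swap_mul_swap_of_nodup (by
      simp [hz.1, hz.2.1, hzw, hx, Ne.symm hw.2.1, Ne.symm hw.1])),
      nchar_eq_classChar ρ h3'.cycleType, nchar_eq_classChar ρ h3.cycleType] at h4
    rw [nchar_eq_classChar ρ h3.cycleType] at h
    linarith

end Uniform

section Recursion

open Equiv Equiv.Perm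

/-- The restriction of a representation to an invariant subspace. -/
def restrictRep {G V : Type} [Group G] [AddCommGroup V] [Module ℂ V]
    (ρ : Representation ℂ G V) (p : Submodule ℂ V) (hp : ∀ g, ∀ v ∈ p, ρ g v ∈ p) :
    Representation ℂ G p where
  toFun g := (ρ g).restrict (hp g)
  map_one' := by
    ext v
    simp
  map_mul' g h := by
    ext v
    simp

theorem trace_eq_add_trace_orthogonal {G V : Type} [Group G] [NormedAddCommGroup V]
    [InnerProductSpace ℂ V] [FiniteDimensional ℂ V] (ρ : Representation ℂ G V)
    (p : Submodule ℂ V) (hp : ∀ g, ∀ v ∈ p, ρ g v ∈ p) (hq : ∀ g, ∀ v ∈ pᗮ, ρ g v ∈ pᗮ) (g : G) :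
    LinearMap.trace ℂ V (ρ g) = LinearMap.trace ℂ p (restrictRep ρ p hp g) +
      LinearMap.trace ℂ pᗮ (restrictRep ρ pᗮ hq g) := by
  have h1 : DirectSum.IsInternal (fun b : Bool => cond b p pᗮ) := by
    rw [DirectSum.isInternal_submodule_iff_isCompl _ (i := true) (j := false) (by simp)
      (by ext b; cases b <;> simp)]
    exact p.isCompl_orthogonal
  have h2 : ∀ b : Bool, Set.MapsTo (ρ g) (cond b p pᗮ : Submodule ℂ V)
      (cond b p pᗮ : Submodule ℂ V) := by
    rintro (_ | _)
    exacts [hq g, hp g]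
  rw [LinearMap.trace_eq_sum_trace_restrict h1 h2, Fintype.sum_bool]
  rfl

variable {β : Type} [Fintype β] [DecidableEq β]

/-- A bound for the characters of all irreducible representations other than the trivial and the
sign one extends to their direct sums. -/
theorem trace_re_le_of_forall_goodRep {c : ℝ} {g : Perm β}
    (h : ∀ (W : Type) [NormedAddCommGroup W] [InnerProductSpace ℂ W] [FiniteDimensional ℂ W]
      (τ : Representation ℂ (Perm β) W), GoodRep τ →
        (LinearMap.trace ℂ W (τ g)).re ≤ c * Module.finrank ℂ W) (d : ℕ) :
    ∀ (V : Type) [NormedAddCommGroup V] [InnerProductSpace ℂ V] [FiniteDimensional ℂ V]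
      (ρ : Representation ℂ (Perm β) V), Module.finrank ℂ V = d → IsUnitaryRep ρ →
      (∀ v, (∀ g, ρ g v = v) → v = 0) →
      (∀ v, (∀ g, ρ g v = ((sign g : ℤ) : ℂ) • v) → v = 0) →
        (LinearMap.trace ℂ V (ρ g)).re ≤ c * Module.finrank ℂ V := by
  induction d using Nat.strong_induction_on with
  | _ d ih =>
    intro V _ _ _ ρ hd hu hi hs
    by_cases hirr : IsIrrRep ρ
    · exact h V ρ ⟨hu, hirr, hi, hs⟩
    rcases subsingleton_or_nontrivial V with h0 | h0
    · have h1 : ρ g = 0 := Subsingleton.elim _ _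
      rw [h1, map_zero, Module.finrank_zero_of_subsingleton]
      simp
    have h1 : ∃ p : Submodule ℂ V, (∀ g, ∀ v ∈ p, ρ g v ∈ p) ∧ p ≠ ⊥ ∧ p ≠ ⊤ := by
      by_contra! h1
      exact hirr ⟨h0, fun p hp => or_iff_not_imp_left.2 (h1 p hp)⟩
    obtain ⟨p, hp, hb, ht⟩ := h1
    have hq : ∀ g, ∀ v ∈ pᗮ, ρ g v ∈ pᗮ := fun g v hv w hw => by
      rw [← inv_inv g, ← hu.inner_left]
      exact hv _ (hp _ w hw)
    have hadd := Submodule.finrank_add_finrank_orthogonal p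
    have hp1 : 0 < Module.finrank ℂ p :=
      Nat.pos_of_ne_zero fun h => hb (Submodule.finrank_eq_zero.1 h)
    have hp2 : Module.finrank ℂ p < Module.finrank ℂ V := Submodule.finrank_lt ht
    have key : ∀ (q : Submodule ℂ V) (hq : ∀ g, ∀ v ∈ q, ρ g v ∈ q), Module.finrank ℂ q < d →
        (LinearMap.trace ℂ q (restrictRep ρ q hq g)).re ≤ c * Module.finrank ℂ q := by
      intro q hq hlt
      refine ih _ hlt q (restrictRep ρ q hq) rfl (fun g v w => hu g v w) (fun v hv => ?_)
        (fun v hv => ?_)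
      · exact Subtype.ext (hi v fun g => congrArg Subtype.val (hv g))
      · exact Subtype.ext (hs v fun g => congrArg Subtype.val (hv g))
    have e1 := key p hp (by omega)
    have e2 := key pᗮ hq (by omega)
    rw [trace_eq_add_trace_orthogonal ρ p hp hq g, Complex.add_re, ← hadd]
    push_cast
    linarith

theorem card_filter_fixed_add_card_support (σ : Perm β) :
    (Finset.univ.filter fun x => σ x = x).card + σ.support.card = Fintype.card β :=
  Finset.card_filter_add_card_filter_not _

theorem GoodRep.one_sub_nchar_of_fixedOff {V : Type} [NormedAddCommGroup V]
    [InnerProductSpace ℂ V] [FiniteDimensional ℂ V] {ρ : Representation ℂ (Perm β) V}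
    (hρ : GoodRep ρ) {b : β} {v : V} (hv : FixedOff ρ {b} v) (h0 : v ≠ 0)
    (hn : 2 ≤ Fintype.card β) (σ : Perm β) :
    1 - nchar ρ σ = σ.support.card / (Fintype.card β - 1) := by
  have h2 : (2 : ℝ) ≤ Fintype.card β := by exact_mod_cast hn
  have h3 : ((Finset.univ.filter fun x => σ x = x).card : ℝ) + σ.support.card =
      Fintype.card β := by exact_mod_cast card_filter_fixed_add_card_support σ
  have h4 : (Fintype.card β : ℝ) - 1 ≠ 0 := by linarith
  rw [hρ.nchar_of_fixedOff_singleton hv h0 hn]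
  field_simp
  linarith

theorem GoodRep.le_one_sub_nchar_of_fixedOff_sgnTwist {V : Type} [NormedAddCommGroup V]
    [InnerProductSpace ℂ V] [FiniteDimensional ℂ V] {ρ : Representation ℂ (Perm β) V}
    (hρ : GoodRep ρ) {b : β} {v : V} (hv : FixedOff (_root_.sgnTwist ρ) {b} v) (h0 : v ≠ 0)
    (hn : 2 ≤ Fintype.card β) {σ : Perm β} (hb : σ b = b) :
    σ.support.card / (Fintype.card β - 1) ≤ 1 - nchar ρ σ := by
  have h1 := hρ.sgnTwist.one_sub_nchar_of_fixedOff hv h0 hn σ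
  have h2 : (2 : ℝ) ≤ Fintype.card β := by exact_mod_cast hn
  have h3 : ((Finset.univ.filter fun x => σ x = x).card : ℝ) + σ.support.card =
      Fintype.card β := by exact_mod_cast card_filter_fixed_add_card_support σ
  have h4 : (1 : ℝ) ≤ (Finset.univ.filter fun x => σ x = x).card := by
    exact_mod_cast Finset.card_pos.2 ⟨b, by simpa using hb⟩
  rw [nchar_sgnTwist] at h1
  rcases Int.units_eq_one_or (sign σ) with h | h
  · rw [h] at h1
    push_cast at h1
    linarith
  · rw [h] at h1
    push_cast at h1
    have h5 : (σ.support.card : ℝ) / (Fintype.card β - 1) ≤ 1 := by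
      rw [div_le_one (by linarith)]
      linarith
    linarith

theorem card_support_ofSubtype {p : β → Prop} [DecidablePred p] (τ : Perm (Subtype p)) :
    (ofSubtype τ).support.card = τ.support.card := by
  rw [← sum_cycleType, ← sum_cycleType, cycleType_ofSubtype]

omit [Fintype β] in
theorem exists_ofSubtype_eq {b : β} {g : Perm β} (hb : g b = b) :
    ∃ τ : Perm {x // x ≠ b}, ofSubtype τ = g := by
  have h1 : ∀ x, g x ≠ b ↔ x ≠ b := fun x => by
    rw [not_iff_not]
    exact ⟨fun h => g.injective (h.trans hb.symm), fun h => h ▸ hb⟩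
  exact ⟨g.subtypePerm h1, ofSubtype_subtypePerm h1 fun x hx h => hx (h ▸ hb)⟩

/-- If no vector is fixed, even up to sign, by a point stabilizer, then a character bound for the
point stabilizer carries over. -/
theorem GoodRep.nchar_le_of_restrict {V : Type} [NormedAddCommGroup V]
    [InnerProductSpace ℂ V] [FiniteDimensional ℂ V] {ρ : Representation ℂ (Perm β) V}
    (hρ : GoodRep ρ) {b : β} (h1 : ∀ v, FixedOff ρ {b} v → v = 0)
    (h2 : ∀ v, FixedOff (_root_.sgnTwist ρ) {b} v → v = 0) {c : ℝ} {τ : Perm {x // x ≠ b}}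
    (h : ∀ (W : Type) [NormedAddCommGroup W] [InnerProductSpace ℂ W] [FiniteDimensional ℂ W]
      (κ : Representation ℂ (Perm {x // x ≠ b}) W), GoodRep κ → nchar κ τ ≤ c) :
    nchar ρ (ofSubtype τ) ≤ c := by
  have := hρ.irr.1
  have hpos : (0 : ℝ) < Module.finrank ℂ V := by exact_mod_cast Module.finrank_pos
  unfold nchar
  rw [div_le_iff₀ hpos]
  refine trace_re_le_of_forall_goodRep (c := c) (g := τ) ?_ _ V (ρ.comp ofSubtype) rfl
    (fun g => hρ.unitary _) (fun v hv => h1 v fun g hg => ?_) (fun v hv => h2 v fun g hg => ?_)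
  · intro W _ _ _ κ hκ
    have := hκ.irr.1
    have hpos : (0 : ℝ) < Module.finrank ℂ W := by exact_mod_cast Module.finrank_pos
    rw [← div_le_iff₀ hpos]
    exact h W κ hκ
  · obtain ⟨τ', rfl⟩ := exists_ofSubtype_eq (hg b (by simp))
    exact hv τ'
  · obtain ⟨τ', rfl⟩ := exists_ofSubtype_eq (hg b (by simp))
    have h3 : ρ (ofSubtype τ') v = ((sign τ' : ℤ) : ℂ) • v := hv τ'
    rw [sgnTwist_apply, h3, sign_ofSubtype, sign_smul_sign_smul]

theorem exists_forall_min_mul_card_support_le {ε : ℝ} (hε : 0 < ε) (hε1 : ε < 1) :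
    ∃ N : ℕ, ∃ b₀ : ℝ, 0 < b₀ ∧ 2 ≤ N ∧ ∀ n, N ≤ n →
      ∀ (α V : Type) [Fintype α] [DecidableEq α] [NormedAddCommGroup V] [InnerProductSpace ℂ V]
        [FiniteDimensional ℂ V] (ρ : Representation ℂ (Perm α) V), Fintype.card α = n →
        GoodRep ρ → ∀ σ : Perm α,
          min b₀ ((1 - ε) / (n - 1)) * σ.support.card ≤ 1 - nchar ρ σ := by
  obtain ⟨N₀, hN₀, hder⟩ := exists_forall_abs_nchar_le (half_pos hε)
  obtain ⟨N₁, hN₁⟩ := exists_nat_ge (2 / ε)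
  set N := max N₀ N₁
  have hN32 : 32 ≤ N := hN₀.trans (le_max_left _ _)
  have hNR : (32 : ℝ) ≤ N := by exact_mod_cast hN32
  refine ⟨N, 1 / (16 * (N : ℝ) ^ 2), by positivity, by omega, fun n hn => ?_⟩
  induction n, hn using Nat.le_induction with
  | base =>
    intro α V _ _ _ _ _ ρ hcard hρ σ
    have := hρ.irr.1
    by_cases hσ : σ = 1
    · subst hσ
      rw [nchar_one]
      simp
    have h1 := hρ.one_sub_classChar_le (by omega) hσ
    have h2 := hρ.one_le_card_mul_one_sub (by omega)
    rw [hcard] at h2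
    have h3 : (σ.support.card : ℝ) ≤ N := by
      rw [← hcard]
      exact_mod_cast Finset.card_le_univ _
    have h5 : (1 : ℝ) / (16 * N) ≤ 1 - nchar ρ σ := by
      rw [div_le_iff₀ (by positivity)]
      nlinarith
    calc _ ≤ 1 / (16 * (N : ℝ) ^ 2) * N := by
          apply mul_le_mul (min_le_left _ _) h3 (by positivity) (by positivity)
      _ = 1 / (16 * N) := by
          field_simp
      _ ≤ _ := h5
  | succ n hn ih =>
    intro α V _ _ _ _ _ ρ hcard hρ σ
    have hnN : (N : ℝ) ≤ n := by exact_mod_cast hn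
    have hn0 : (0 : ℝ) < n := by linarith
    push_cast
    rw [add_sub_cancel_right]
    by_cases hσ : ∀ x, σ x ≠ x
    · have hN : N₀ ≤ N := le_max_left _ _
      have h1 := hder α V ρ (by omega) hρ σ hσ
      have h2 : σ.support.card = n + 1 := by
        rw [← hcard, ← Finset.card_univ]
        congr 1
        ext x
        simpa using hσ x
      have h3 : 2 / ε ≤ n := hN₁.trans ((Nat.cast_le.2 (le_max_right N₀ N₁)).trans hnN)
      rw [div_le_iff₀ hε] at h3
      have h4 : (1 - ε) / n * (n + 1) ≤ 1 - ε / 2 := by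
        rw [div_mul_eq_mul_div, div_le_iff₀ hn0]
        nlinarith
      rw [h2]
      push_cast
      calc _ ≤ (1 - ε) / n * (n + 1) := by gcongr; exact min_le_right _ _
        _ ≤ 1 - ε / 2 := h4
        _ ≤ _ := by linarith [le_abs_self (nchar ρ σ)]
    push Not at hσ
    obtain ⟨b, hb⟩ := hσ
    have hstd : min (1 / (16 * (N : ℝ) ^ 2)) ((1 - ε) / n) * σ.support.card ≤
        σ.support.card / (Fintype.card α - 1) := by
      rw [hcard]
      push_cast
      rw [add_sub_cancel_right, div_eq_inv_mul (σ.support.card : ℝ)]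
      gcongr
      refine (min_le_right _ _).trans ?_
      rw [inv_eq_one_div]
      gcongr
      linarith
    by_cases h1 : ∀ v, FixedOff ρ {b} v → v = 0
    swap
    · push Not at h1
      obtain ⟨v, hv, h0⟩ := h1
      rw [hρ.one_sub_nchar_of_fixedOff hv h0 (by omega)]
      exact hstd
    by_cases h2 : ∀ v, FixedOff (sgnTwist ρ) {b} v → v = 0
    swap
    · push Not at h2
      obtain ⟨v, hv, h0⟩ := h2
      exact hstd.trans (hρ.le_one_sub_nchar_of_fixedOff_sgnTwist hv h0 (by omega) hb)
    obtain ⟨τ, rfl⟩ := exists_ofSubtype_eq hb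
    have hc : Fintype.card {x // x ≠ b} = n := by
      rw [Fintype.card_subtype_compl, hcard, Fintype.card_subtype_eq, Nat.add_sub_cancel]
    have h3 := hρ.nchar_le_of_restrict h1 h2
      (c := 1 - min (1 / (16 * (N : ℝ) ^ 2)) ((1 - ε) / (n - 1)) * τ.support.card)
      (τ := τ) fun W _ _ _ κ hκ => by
        linarith [ih {x // x ≠ b} W κ hc hκ τ]
    rw [card_support_ofSubtype]
    have h4 : min (1 / (16 * (N : ℝ) ^ 2)) ((1 - ε) / n) ≤
        min (1 / (16 * (N : ℝ) ^ 2)) ((1 - ε) / (n - 1)) := by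
      gcongr
      · linarith
      · linarith
    have h5 := mul_le_mul_of_nonneg_right h4 (Nat.cast_nonneg (α := ℝ) τ.support.card)
    linarith

theorem exists_forall_mul_card_support_le {ε : ℝ} (hε : 0 < ε) (hε1 : ε < 1) :
    ∃ N : ℕ, 2 ≤ N ∧ ∀ (α V : Type) [Fintype α] [DecidableEq α] [NormedAddCommGroup V]
      [InnerProductSpace ℂ V] [FiniteDimensional ℂ V] (ρ : Representation ℂ (Perm α) V),
      N ≤ Fintype.card α → GoodRep ρ → ∀ σ : Perm α,
        (1 - ε) * (σ.support.card / (Fintype.card α - 1)) ≤ 1 - nchar ρ σ := by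
  obtain ⟨N, b₀, hb, hN2, h⟩ := exists_forall_min_mul_card_support_le hε hε1
  obtain ⟨M, hM⟩ := exists_nat_ge (1 / b₀ + 1)
  refine ⟨max N M, hN2.trans (le_max_left _ _), fun α V _ _ _ _ _ ρ hcard hρ σ => ?_⟩
  have h1 := h _ ((le_max_left _ _).trans hcard) α V ρ rfl hρ σ
  have h2 : 1 / b₀ + 1 ≤ Fintype.card α :=
    hM.trans (Nat.cast_le.2 ((le_max_right _ _).trans hcard))
  have h3 : 0 < 1 / b₀ := by positivity
  have h4 : (1 - ε) / ((Fintype.card α : ℝ) - 1) ≤ b₀ := by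
    have h5 : 1 / b₀ ≤ (Fintype.card α : ℝ) - 1 := by linarith
    rw [div_le_iff₀ hb] at h5
    rw [div_le_iff₀ (by linarith)]
    linarith
  rw [min_eq_right h4] at h1
  calc _ = (1 - ε) / ((Fintype.card α : ℝ) - 1) * σ.support.card := by ring
    _ ≤ _ := h1

end Recursion

section Bridge

theorem FDRep.isIrrRep_of_simple {G : Type} [Group G] (V : FDRep ℂ G) [Simple V] :
    IsIrrRep (V := V) V.ρ := by
  constructor
  · by_contra h
    rw [not_nontrivial_iff_subsingleton] at h
    refine id_nonzero V ?_
    ext v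
    exact Subsingleton.elim (α := V) _ _
  · intro p hp
    let i : FDRep.of (restrictRep (V := V) V.ρ p hp) ⟶ V :=
      ⟨InducedCategory.homMk (ModuleCat.ofHom p.subtype), fun g => rfl⟩
    have hi : Mono i := by
      apply ConcreteCategory.mono_of_injective
      exact Subtype.val_injective
    by_cases h0 : i = 0
    · left
      rw [Submodule.eq_bot_iff]
      intro v hv
      have := ConcreteCategory.congr_hom h0 (⟨v, hv⟩ : p)
      exact this
    · right
      have := isIso_of_mono_of_nonzero h0
      rw [eq_top_iff]
      intro v _
      let e := FDRep.isoToLinearEquiv (asIso i)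
      rw [← e.apply_symm_apply v]
      exact (e.symm v).2

/-- An irreducible representation containing a vector on which the group acts through `χ` has
character `χ`. -/
theorem IsIrrRep.trace_eq {G V : Type} [Group G] [AddCommGroup V] [Module ℂ V]
    {ρ : Representation ℂ G V} (hρ : IsIrrRep ρ) {χ : G → ℂ} {v : V} (h0 : v ≠ 0)
    (hv : ∀ g, ρ g v = χ g • v) (g : G) : LinearMap.trace ℂ V (ρ g) = χ g := by
  have h1 : ℂ ∙ v = ⊤ := by
    refine (hρ.2 (ℂ ∙ v) fun g w hw => ?_).resolve_left (by simpa using h0)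
    obtain ⟨c, rfl⟩ := Submodule.mem_span_singleton.1 hw
    rw [map_smul, hv, smul_comm]
    exact Submodule.smul_mem _ _ (Submodule.smul_mem _ _ (Submodule.mem_span_singleton_self v))
  have h2 : ρ g = χ g • LinearMap.id := by
    ext w
    obtain ⟨c, rfl⟩ := Submodule.mem_span_singleton.1 (h1 ▸ Submodule.mem_top : w ∈ ℂ ∙ v)
    rw [map_smul, hv]
    exact smul_comm _ _ _
  have h3 : Module.finrank ℂ V = 1 := (finrank_eq_one_iff_of_nonzero v h0).2 h1
  have := Module.finite_of_finrank_pos (R := ℂ) (M := V) (by omega)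
  rw [h2, map_smul, LinearMap.trace_id, h3]
  simp

/-- Weyl's unitary trick. -/
theorem exists_invariant_core {G V : Type} [Group G] [Fintype G] [AddCommGroup V] [Module ℂ V]
    [FiniteDimensional ℂ V] (ρ : Representation ℂ G V) :
    ∃ c : InnerProductSpace.Core ℂ V, ∀ g v w, c.inner (ρ g v) (ρ g w) = c.inner v w := by
  let b := Module.finBasis ℂ V
  let φ : V ≃ₗ[ℂ] EuclideanSpace ℂ (Fin (Module.finrank ℂ V)) :=
    b.equivFun.trans (WithLp.linearEquiv 2 ℂ _).symm
  refine ⟨{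
    inner v w := ∑ g, inner ℂ (φ (ρ g v)) (φ (ρ g w))
    conj_inner_symm v w := by simp [map_sum]
    re_inner_nonneg v := by
      rw [map_sum]
      exact Finset.sum_nonneg fun g _ => inner_self_nonneg
    add_left v w u := by simp [Finset.sum_add_distrib]
    smul_left v w r := by simp [Finset.mul_sum, mul_comm]
    definite v hv := by
      have h1 : ∑ g, ‖φ (ρ g v)‖ ^ 2 = 0 := by
        have h2 : ∑ g, (inner ℂ (φ (ρ g v)) (φ (ρ g v)) : ℂ) = 0 := hv
        simp_rw [inner_self_eq_norm_sq_to_K] at h2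
        simpa [← Complex.ofReal_pow] using congrArg Complex.re h2
      rw [Finset.sum_eq_zero_iff_of_nonneg fun g _ => by positivity] at h1
      simpa using h1 1 (Finset.mem_univ 1) }, fun g v w => ?_⟩
  refine Fintype.sum_equiv (Equiv.mulRight g) _ _ fun h => ?_
  simp

open Equiv Equiv.Perm

theorem le_one_sub_nchar_of_forall_goodRep {α V : Type} [Fintype α] [DecidableEq α]
    [AddCommGroup V] [Module ℂ V] [FiniteDimensional ℂ V] {ρ : Representation ℂ (Perm α) V}
    (hρ : IsIrrRep ρ) (h1 : (fun g => LinearMap.trace ℂ V (ρ g)) ≠ fun _ => 1)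
    (h2 : (fun g => LinearMap.trace ℂ V (ρ g)) ≠ fun g => ((sign g : ℤ) : ℂ)) {x : ℝ} {σ : Perm α}
    (h : ∀ (W : Type) [NormedAddCommGroup W] [InnerProductSpace ℂ W] [FiniteDimensional ℂ W]
      (τ : Representation ℂ (Perm α) W), GoodRep τ → x ≤ 1 - nchar τ σ) :
    x ≤ 1 - nchar ρ σ := by
  obtain ⟨c, hc⟩ := exists_invariant_core ρ
  let _ := c.toNormedAddCommGroup
  let _ := InnerProductSpace.ofCore c.toCore
  refine h V ρ ⟨hc, hρ, fun v hv => ?_, fun v hv => ?_⟩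
  · by_contra h0
    exact h1 (funext fun g => hρ.trace_eq (χ := fun _ => 1) h0 (by simpa using hv) g)
  · by_contra h0
    exact h2 (funext fun g => hρ.trace_eq (χ := fun g => ((sign g : ℤ) : ℂ)) h0 hv g)

theorem normChar_eq_nchar {n : ℕ} (V : FDRep ℂ (Perm (Fin n))) (σ : Perm (Fin n)) :
    normChar V σ = nchar (V := V) V.ρ σ := by
  unfold normChar nchar
  rw [FDRep.char_one, Complex.div_natCast_re]
  rfl

theorem IsNontrivIrr.le_one_sub_normChar {n : ℕ} {V : FDRep ℂ (Perm (Fin n))}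
    (hV : IsNontrivIrr V) {x : ℝ} {σ : Perm (Fin n)}
    (h : ∀ (W : Type) [NormedAddCommGroup W] [InnerProductSpace ℂ W] [FiniteDimensional ℂ W]
      (τ : Representation ℂ (Perm (Fin n)) W), GoodRep τ → x ≤ 1 - nchar τ σ) :
    x ≤ 1 - normChar V σ := by
  obtain ⟨hs, h1, h2⟩ := hV
  rw [normChar_eq_nchar]
  exact le_one_sub_nchar_of_forall_goodRep (V := V) (FDRep.isIrrRep_of_simple V) h1 h2 h

end Bridge

/-- **Lemma (std almost rules for any σ).** For every `ε > 0` there is `N` such that for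
every `n ≥ N`, every `σ ∈ S_n` and every irreducible character `χ ∉ {triv, sgn}` of `S_n`:
`1 - χ̃(σ) ≥ (1 - (c₁(σ)-1)/(n-1))·(1 - ε)`. -/
theorem std_almost_rules (ε : ℝ) (hε : 0 < ε) :
    ∃ N : ℕ, ∀ n : ℕ, n ≥ N → ∀ σ : Equiv.Perm (Fin n),
      ∀ V : FDRep ℂ (Equiv.Perm (Fin n)), IsNontrivIrr V →
        1 - normChar V σ ≥ (1 - ((fixCount σ : ℝ) - 1) / ((n : ℝ) - 1)) * (1 - ε) := by
  obtain ⟨N, hN2, h⟩ := exists_forall_mul_card_support_le (ε := min ε (1 / 2))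
    (by positivity) ((min_le_right _ _).trans_lt (by norm_num))
  refine ⟨N, fun n hn σ V hV => ?_⟩
  have hn2 : (2 : ℝ) ≤ n := by exact_mod_cast hN2.trans hn
  have h1 : (fixCount σ : ℝ) + σ.support.card = n := by
    have h2 := card_filter_fixed_add_card_support σ
    rw [Fintype.card_fin] at h2
    exact_mod_cast h2
  have h2 : 1 - ((fixCount σ : ℝ) - 1) / ((n : ℝ) - 1) = σ.support.card / ((n : ℝ) - 1) := by
    have h3 : (n : ℝ) - 1 ≠ 0 := by linarith
    field_simp
    linarith
  have h3 : 0 ≤ (σ.support.card : ℝ) / ((n : ℝ) - 1) := div_nonneg (by positivity) (by linarith)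
  rw [h2]
  calc _ ≤ (1 - min ε (1 / 2)) * (σ.support.card / ((n : ℝ) - 1)) := by
        rw [mul_comm]
        gcongr
        exact min_le_left _ _
    _ ≤ _ := hV.le_one_sub_normChar fun W _ _ _ τ hτ => by
        simpa only [Fintype.card_fin] using h (Fin n) W τ (by simpa using hn) hτ σ
end

section
/- Let σ ∈ S_16 be a permutation of cycle type (5,5,5,1), i.e. a product of three disjoint 5-cycles with one fixed point. Then there exists an irreducible complex character χ of S_16, other than the trivial and sign characters, with χ̃(σ) > max{F₁(σ), ..., F₈(σ)} = 1/896. (The largest non-trivial eigenvalue of the Cayley graph of S_16 with respect to this conjugacy class is associated with the irrep (11,5) and its transpose, and exceeds the eigenvalues of all eight irreps in EIGHT_16; hence Theorem 1.3 fails for n = 16.) -/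
open CategoryTheory

namespace LinearMap
variable {K V W : Type*} [Field K] [AddCommGroup V] [Module K V]
  [AddCommGroup W] [Module K W] [FiniteDimensional K W]

lemma isCompl_ker_range_of_comp_injective {D : V →ₗ[K] W} {U : W →ₗ[K] V}
    (h : Function.Injective (D ∘ₗ U)) : IsCompl (ker D) (range U) := by
  have hs : Function.Surjective (D ∘ₗ U) := injective_iff_surjective.1 h
  constructor
  · rw [Submodule.disjoint_def]
    rintro _ hx ⟨y, rfl⟩
    rw [h (a₁ := y) (a₂ := 0) (by simpa using hx), map_zero]
  · rw [codisjoint_iff, eq_top_iff]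
    intro x _
    obtain ⟨y, hy⟩ := hs (D x)
    exact Submodule.mem_sup.2
      ⟨x - U y, by simpa [sub_eq_zero] using hy.symm, U y, ⟨y, rfl⟩, by simp⟩

variable [FiniteDimensional K V]

lemma trace_eq_add_of_isCompl {p q : Submodule K V} (h : IsCompl p q) (f : V →ₗ[K] V)
    (hp : ∀ x ∈ p, f x ∈ p) (hq : ∀ x ∈ q, f x ∈ q) :
    trace K V f = trace K p (f.restrict hp) + trace K q (f.restrict hq) := by
  have hN : DirectSum.IsInternal (fun b : Bool => cond b p q) :=
    (DirectSum.isInternal_submodule_iff_isCompl _ (i := true) (j := false) (by decide)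
      (by ext b; cases b <;> simp)).2 h
  have hf : ∀ b : Bool, Set.MapsTo f (cond b p q : Submodule K V) (cond b p q : Submodule K V) := by
    rintro (_ | _)
    exacts [hq, hp]
  rw [trace_eq_sum_trace_restrict hN hf, Fintype.sum_bool]
  rfl

lemma trace_eq_trace_restrict_ker_add {D : V →ₗ[K] W} {U : W →ₗ[K] V}
    (h : Function.Injective (D ∘ₗ U)) (f : V →ₗ[K] V) (g : W →ₗ[K] W)
    (hU : ∀ y, f (U y) = U (g y)) (hD : ∀ x ∈ ker D, f x ∈ ker D) :
    trace K V f = trace K (ker D) (f.restrict hD) + trace K W g := by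
  have hR : ∀ x ∈ range U, f x ∈ range U := by
    rintro _ ⟨y, rfl⟩
    exact ⟨g y, (hU y).symm⟩
  have hUi : Function.Injective U := by
    rw [coe_comp] at h
    exact h.of_comp
  rw [trace_eq_add_of_isCompl (isCompl_ker_range_of_comp_injective h) f hD hR]
  congr 1
  rw [← trace_conj' g (LinearEquiv.ofInjective U hUi)]
  congr 1
  ext ⟨_, y, rfl⟩
  have : (LinearEquiv.ofInjective U hUi).symm ⟨U y, y, rfl⟩ = y := by
    rw [LinearEquiv.symm_apply_eq]; rfl
  simp [LinearEquiv.conj_apply, this, hU]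

end LinearMap

namespace Representation

lemma fdRep_of_simple {G V : Type} [Group G] [Finite G] [AddCommGroup V] [Module ℂ V]
    [FiniteDimensional ℂ V] (ρ : Representation ℂ G V) [IsIrreducible ρ] :
    Simple (FDRep.of ρ) := by
  have := Fintype.ofFinite G
  have := invertibleOfNonzero (NeZero.ne (Nat.card G : ℂ))
  rw [FDRep.simple_iff_char_is_norm_one]
  have h := char_orthonormal ρ ρ
  rw [if_pos ⟨Equiv.refl ρ⟩, inv_mul_eq_one₀ (NeZero.ne _)] at h
  exact h.symm

/-- If `Re χ(g) > c · dim`, the same holds for some irreducible constituent. -/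
lemma exists_irreducible_of_lt_re_character {G : Type} [Group G] [Finite G] (g : G) (c : ℝ)
    {V : Type} [AddCommGroup V] [Module ℂ V] [FiniteDimensional ℂ V]
    (ρ : Representation ℂ G V) (h : c * Module.finrank ℂ V < (ρ.character g).re) :
    ∃ (W : Type) (_ : AddCommGroup W) (_ : Module ℂ W) (_ : FiniteDimensional ℂ W)
      (τ : Representation ℂ G W) (f : W →ₗ[ℂ] V), IsIrreducible τ ∧ Function.Injective f ∧
      (∀ a w, f (τ a w) = ρ a (f w)) ∧ c * Module.finrank ℂ W < (τ.character g).re := by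
  induction hn : Module.finrank ℂ V using Nat.strong_induction_on generalizing V with
  | _ n ih =>
  subst hn
  by_cases hirr : IsIrreducible ρ
  · exact ⟨V, _, _, ‹_›, ρ, LinearMap.id, hirr, Function.injective_id, fun _ _ => rfl, h⟩
  have hnt : Nontrivial (Subrepresentation ρ) := by
    by_contra hs
    rw [not_nontrivial_iff_subsingleton] at hs
    have hbt : (⊥ : Submodule ℂ V) = ⊤ :=
      congrArg Subrepresentation.toSubmodule (Subsingleton.elim (⊥ : Subrepresentation ρ) ⊤)
    have hV : Subsingleton V := by
      rwa [← Submodule.subsingleton_iff ℂ, ← subsingleton_iff_bot_eq_top]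
    have h0 : ρ g = 0 := Subsingleton.elim _ _
    simp [character, h0, Module.finrank_zero_of_subsingleton] at h
  obtain ⟨p, hp0, hp1⟩ : ∃ p : Subrepresentation ρ, p ≠ ⊥ ∧ p ≠ ⊤ := by
    by_contra! hall
    exact hirr ⟨fun p => or_iff_not_imp_left.2 (hall p)⟩
  obtain ⟨q, hpq⟩ := exists_isCompl p
  have hc : IsCompl p.toSubmodule q.toSubmodule := by
    constructor
    · rw [disjoint_iff]
      exact congrArg Subrepresentation.toSubmodule hpq.inf_eq_bot
    · rw [codisjoint_iff]
      exact congrArg Subrepresentation.toSubmodule hpq.sup_eq_top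
  have hp0' : p.toSubmodule ≠ ⊥ := fun e => hp0 (Subrepresentation.toSubmodule_injective e)
  have hp1' : p.toSubmodule ≠ ⊤ := fun e => hp1 (Subrepresentation.toSubmodule_injective e)
  have hdim := Submodule.finrank_add_eq_of_isCompl hc
  have hpd := Submodule.finrank_lt hp1'
  have hpp : 0 < Module.finrank ℂ p.toSubmodule := by
    rwa [Nat.pos_iff_ne_zero, ne_eq, Submodule.finrank_eq_zero]
  have htr : ρ.character g = p.toRepresentation.character g + q.toRepresentation.character g :=
    LinearMap.trace_eq_add_of_isCompl hc (ρ g) (p.apply_mem_toSubmodule g)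
      (q.apply_mem_toSubmodule g)
  have key : ∀ r : Subrepresentation ρ, Module.finrank ℂ r.toSubmodule < Module.finrank ℂ V →
      c * Module.finrank ℂ r.toSubmodule < (r.toRepresentation.character g).re →
      ∃ (W : Type) (_ : AddCommGroup W) (_ : Module ℂ W) (_ : FiniteDimensional ℂ W)
      (τ : Representation ℂ G W) (f : W →ₗ[ℂ] V), IsIrreducible τ ∧ Function.Injective f ∧
      (∀ a w, f (τ a w) = ρ a (f w)) ∧ c * Module.finrank ℂ W < (τ.character g).re := by
    intro r hr hrc
    obtain ⟨W, i1, i2, i3, τ, f, hτ, hf, hfe, hlt⟩ := ih _ hr r.toRepresentation hrc rfl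
    exact ⟨W, i1, i2, i3, τ, r.toSubmodule.subtype ∘ₗ f, hτ,
      r.toSubmodule.injective_subtype.comp hf,
      fun a w => congrArg Subtype.val (hfe a w), hlt⟩
  rw [htr, Complex.add_re, ← hdim, Nat.cast_add, mul_add] at h
  by_cases hlt : c * Module.finrank ℂ p.toSubmodule < (p.toRepresentation.character g).re
  · exact key p hpd hlt
  · exact key q (by omega) (by linarith)

/-- If `D ∘ U` is injective and `ρ - σ` has large character at `g`, then `ρ` has an irreducible
constituent inside `ker D` with large character at `g`. -/
lemma exists_irreducible_of_lt_re_character_sub {G : Type} [Group G] [Finite G] (g : G) (c : ℝ)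
    {V W : Type} [AddCommGroup V] [Module ℂ V] [FiniteDimensional ℂ V]
    [AddCommGroup W] [Module ℂ W] [FiniteDimensional ℂ W]
    (ρ : Representation ℂ G V) (σ : Representation ℂ G W) {D : V →ₗ[ℂ] W} {U : W →ₗ[ℂ] V}
    (hDU : Function.Injective (D ∘ₗ U)) (hD : ∀ a x, D (ρ a x) = σ a (D x))
    (hU : ∀ a y, ρ a (U y) = U (σ a y))
    (h : c * ((ρ.character 1).re - (σ.character 1).re) <
      (ρ.character g).re - (σ.character g).re) :
    ∃ (X : Type) (_ : AddCommGroup X) (_ : Module ℂ X) (_ : FiniteDimensional ℂ X)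
      (τ : Representation ℂ G X) (f : X →ₗ[ℂ] V), IsIrreducible τ ∧ Function.Injective f ∧
      (∀ a x, f (τ a x) = ρ a (f x)) ∧ (∀ x, D (f x) = 0) ∧
      c * Module.finrank ℂ X < (τ.character g).re := by
  let κ : Subrepresentation ρ :=
    { toSubmodule := LinearMap.ker D
      apply_mem_toSubmodule := fun a x hx => by
        rw [LinearMap.mem_ker] at hx ⊢
        rw [hD, hx, map_zero] }
  have hχ : ∀ a, ρ.character a = κ.toRepresentation.character a + σ.character a := fun a =>
    LinearMap.trace_eq_trace_restrict_ker_add hDU (ρ a) (σ a) (hU a) (κ.apply_mem_toSubmodule a)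
  rw [hχ 1, hχ g, Complex.add_re, Complex.add_re, add_sub_cancel_right, add_sub_cancel_right,
    char_one, Complex.natCast_re] at h
  obtain ⟨X, i1, i2, i3, τ, f, hτ, hf, hfe, hlt⟩ :=
    exists_irreducible_of_lt_re_character g c κ.toRepresentation h
  exact ⟨X, i1, i2, i3, τ, κ.toSubmodule.subtype ∘ₗ f, hτ, κ.toSubmodule.injective_subtype.comp hf,
    fun a x => congrArg Subtype.val (hfe a x), fun x => (f x).2, hlt⟩

/-- A one-dimensional representation acts through its character. -/
lemma apply_eq_character_smul {G V : Type} [Group G] [AddCommGroup V] [Module ℂ V]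
    (ρ : Representation ℂ G V) (h : Module.finrank ℂ V = 1) (g : G) (v : V) :
    ρ g v = ρ.character g • v := by
  obtain ⟨c, hc, -⟩ := LinearMap.existsUnique_eq_smul_id_of_finrank_eq_one h (ρ g)
  have := Module.finite_of_finrank_pos (R := ℂ) (M := V) (by omega)
  simp [character, hc, h, LinearMap.trace_id]

end Representation

section SetRep

open scoped Pointwise

variable (α : Type) [DecidableEq α]

/-- The permutation representation on complex functions on the subsets of `α`. -/
def setRep : Representation ℂ (Equiv.Perm α) (Finset α → ℂ) where
  toFun g := LinearMap.funLeft ℂ ℂ (fun s : Finset α => g⁻¹ • s)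
  map_one' := by ext; simp [LinearMap.funLeft]
  map_mul' g h := by ext; simp [LinearMap.funLeft, mul_smul]

variable {α}

@[simp]
lemma setRep_apply (g : Equiv.Perm α) (f : Finset α → ℂ) (s : Finset α) :
    setRep α g f s = f (g⁻¹ • s) := rfl

/-- Functions supported on the `k`-subsets. -/
def level (k : ℕ) : Submodule ℂ (Finset α → ℂ) where
  carrier := {f | ∀ s, s.card ≠ k → f s = 0}
  zero_mem' := fun _ _ => rfl
  add_mem' := fun hf hg s hs => by simp [hf s hs, hg s hs]
  smul_mem' := fun c f hf s hs => by simp [hf s hs]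

lemma setRep_mem_level {k : ℕ} (g : Equiv.Perm α) {f : Finset α → ℂ} (hf : f ∈ level k) :
    setRep α g f ∈ level k := fun s hs => hf _ (by simpa using hs)

/-- The level-`k` functions as a subrepresentation. -/
def levelRep (k : ℕ) : Subrepresentation (setRep α) where
  toSubmodule := level k
  apply_mem_toSubmodule g _ hf := setRep_mem_level g hf

/-- The raising operator: sum of the values on the subsets obtained by erasing a point. -/
def raise : (Finset α → ℂ) →ₗ[ℂ] (Finset α → ℂ) where
  toFun f s := ∑ i ∈ s, f (s.erase i)
  map_add' f g := by ext; simp [Finset.sum_add_distrib]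
  map_smul' c f := by ext; simp [Finset.mul_sum]

lemma raise_apply (f : Finset α → ℂ) (s : Finset α) : raise f s = ∑ i ∈ s, f (s.erase i) := rfl

lemma raise_setRep (g : Equiv.Perm α) (f : Finset α → ℂ) :
    raise (setRep α g f) = setRep α g (raise f) := by
  ext s
  have hinj := MulAction.injective (β := α) g⁻¹
  rw [setRep_apply, raise_apply, raise_apply, Finset.smul_finset_def,
    Finset.sum_image hinj.injOn]
  refine Finset.sum_congr rfl fun i _ => ?_
  rw [setRep_apply, Finset.smul_finset_def, Finset.image_erase hinj]

lemma raise_mem_level {k : ℕ} {f : Finset α → ℂ} (hf : f ∈ level k) : raise f ∈ level (k + 1) := by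
  intro s hs
  refine Finset.sum_eq_zero fun i hi => hf _ ?_
  have := Finset.card_erase_add_one hi
  omega

lemma raise_star (f : Finset α → ℂ) : raise (star f) = star (raise f) := by
  ext s; simp [raise_apply]

variable [Fintype α]

/-- The lowering operator: sum of the values on the sets obtained by inserting a new point. -/
def lower : (Finset α → ℂ) →ₗ[ℂ] (Finset α → ℂ) where
  toFun f s := ∑ i ∈ sᶜ, f (insert i s)
  map_add' f g := by ext; simp [Finset.sum_add_distrib]
  map_smul' c f := by ext; simp [Finset.mul_sum]

lemma lower_apply (f : Finset α → ℂ) (s : Finset α) : lower f s = ∑ i ∈ sᶜ, f (insert i s) := rfl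

lemma lower_setRep (g : Equiv.Perm α) (f : Finset α → ℂ) :
    lower (setRep α g f) = setRep α g (lower f) := by
  ext s
  have hinj := MulAction.injective (β := α) g⁻¹
  have hcompl : (g⁻¹ • s)ᶜ = g⁻¹ • sᶜ := by
    rw [Finset.compl_eq_univ_sdiff, Finset.compl_eq_univ_sdiff, Finset.smul_finset_sdiff,
      Finset.smul_finset_univ]
  rw [setRep_apply, lower_apply, lower_apply, hcompl, Finset.smul_finset_def,
    Finset.smul_finset_def, Finset.sum_image hinj.injOn]
  refine Finset.sum_congr rfl fun i _ => ?_
  rw [setRep_apply, Finset.smul_finset_def, Finset.image_insert]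

lemma lower_mem_level {k : ℕ} {f : Finset α → ℂ} (hf : f ∈ level (k + 1)) : lower f ∈ level k := by
  intro s hs
  refine Finset.sum_eq_zero fun i hi => hf _ ?_
  rw [Finset.card_insert_of_notMem (Finset.mem_compl.1 hi)]
  omega

lemma lower_raise_apply (f : Finset α → ℂ) (s : Finset α) :
    lower (raise f) s + s.card * f s = raise (lower f) s + sᶜ.card * f s := by
  have h1 : lower (raise f) s =
      sᶜ.card * f s + ∑ i ∈ sᶜ, ∑ j ∈ s, f ((insert i s).erase j) := by
    rw [lower_apply, ← nsmul_eq_mul, ← Finset.sum_const, ← Finset.sum_add_distrib]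
    refine Finset.sum_congr rfl fun i hi => ?_
    have hi' := Finset.mem_compl.1 hi
    rw [raise_apply, Finset.sum_insert hi', Finset.erase_insert hi']
  have h2 : raise (lower f) s =
      s.card * f s + ∑ j ∈ s, ∑ i ∈ sᶜ, f ((insert i s).erase j) := by
    rw [raise_apply, ← nsmul_eq_mul, ← Finset.sum_const, ← Finset.sum_add_distrib]
    refine Finset.sum_congr rfl fun j hj => ?_
    rw [lower_apply, Finset.compl_erase, Finset.sum_insert (by simpa using hj),
      Finset.insert_erase hj]
    congr 1
    refine Finset.sum_congr rfl fun i hi => ?_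
    rw [Finset.erase_insert_of_ne]
    rintro rfl
    exact Finset.mem_compl.1 hi hj
  rw [h1, h2, Finset.sum_comm]
  ring

lemma sum_mul_raise (f g : Finset α → ℂ) :
    ∑ s, f s * raise g s = ∑ s, lower f s * g s := by
  simp only [raise_apply, lower_apply, Finset.mul_sum, Finset.sum_mul]
  rw [Finset.sum_sigma', Finset.sum_sigma']
  refine Finset.sum_bij' (fun x _ => ⟨x.1.erase x.2, x.2⟩) (fun x _ => ⟨insert x.2 x.1, x.2⟩)
    ?_ ?_ ?_ ?_ ?_
  · rintro ⟨s, i⟩ h; simp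
  · rintro ⟨s, i⟩ h; simp
  · rintro ⟨s, i⟩ h
    simp only [Finset.mem_sigma, Finset.mem_univ, true_and] at h
    simp [Finset.insert_erase h]
  · rintro ⟨s, i⟩ h
    simp only [Finset.mem_sigma, Finset.mem_univ, true_and, Finset.mem_compl] at h
    simp [Finset.erase_insert h]
  · rintro ⟨s, i⟩ h
    simp only [Finset.mem_sigma, Finset.mem_univ, true_and] at h
    simp [Finset.insert_erase h]

lemma lower_star (f : Finset α → ℂ) : lower (star f) = star (lower f) := by
  ext s; simp [lower_apply]

lemma eq_zero_of_lower_raise_eq_zero {k : ℕ} (hk : 2 * k < Fintype.card α) {f : Finset α → ℂ}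
    (hf : f ∈ level k) (h : lower (raise f) = 0) : f = 0 := by
  have hpt : ∀ s, raise (lower f) s + ((Fintype.card α - 2 * k : ℕ) : ℂ) * f s = 0 := by
    intro s
    by_cases hs : s.card = k
    · have h0 := lower_raise_apply f s
      rw [h, Finset.card_compl, hs, Nat.cast_sub (by omega)] at h0
      rw [Nat.cast_sub hk.le]
      push_cast
      simp only [Pi.zero_apply] at h0
      linear_combination -h0
    · have h0 := lower_raise_apply f s
      rw [h, hf s hs] at h0
      simpa [hf s hs] using h0.symm
  have hsum : ∑ s, star (lower f s) * lower f s
      + ((Fintype.card α - 2 * k : ℕ) : ℂ) * ∑ s, star (f s) * f s = 0 := by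
    have h1 := sum_mul_raise (star f) (lower f)
    rw [lower_star] at h1
    simp only [Pi.star_apply] at h1
    rw [← h1, Finset.mul_sum, ← Finset.sum_add_distrib]
    refine Finset.sum_eq_zero fun s _ => ?_
    linear_combination star (f s) * hpt s
  have hre : ∑ s, Complex.normSq (lower f s)
      + ((Fintype.card α - 2 * k : ℕ) : ℝ) * ∑ s, Complex.normSq (f s) = 0 := by
    have hc : ∀ z : ℂ, star z * z = (Complex.normSq z : ℂ) := fun z => by
      rw [Complex.normSq_eq_conj_mul_self]; rfl
    simp only [hc] at hsum
    exact_mod_cast hsum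
  have hA : 0 ≤ ∑ s, Complex.normSq (lower f s) :=
    Finset.sum_nonneg fun _ _ => Complex.normSq_nonneg _
  have hB : 0 ≤ ∑ s, Complex.normSq (f s) := Finset.sum_nonneg fun _ _ => Complex.normSq_nonneg _
  have hpos : (0 : ℝ) < ((Fintype.card α - 2 * k : ℕ) : ℝ) := by
    exact_mod_cast Nat.sub_pos_of_lt hk
  have hB0 : ∑ s, Complex.normSq (f s) = 0 := by nlinarith
  rw [Finset.sum_eq_zero_iff_of_nonneg fun _ _ => Complex.normSq_nonneg _] at hB0
  ext s
  exact Complex.normSq_eq_zero.1 (hB0 s (Finset.mem_univ s))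

/-- The character of the permutation representation on `k`-subsets counts fixed `k`-subsets. -/
lemma levelRep_character (k : ℕ) (g : Equiv.Perm α) :
    (levelRep k).toRepresentation.character g =
      ((Finset.univ.filter fun s : Finset α => s.card = k ∧ g • s = s).card : ℂ) := by
  let P : (Finset α → ℂ) →ₗ[ℂ] (Finset α → ℂ) :=
    { toFun := fun f s => if s.card = k then f s else 0
      map_add' := fun f g => by ext s; simp; split_ifs <;> simp
      map_smul' := fun c f => by ext s; simp }
  have hP : ∀ f s, P f s = if s.card = k then f s else 0 := fun _ _ => rfl
  have hmem : ∀ f, (P ∘ₗ setRep α g) f ∈ level k := fun f s hs => by simp [hP, hs]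
  have h1 := LinearMap.trace_restrict_eq_of_forall_mem (level k) (P ∘ₗ setRep α g) hmem
  have h2 : (levelRep k).toRepresentation g =
      (P ∘ₗ setRep α g).restrict (p := level k) (fun x _ => hmem x) := by
    ext ⟨f, hf⟩ s
    change f (g⁻¹ • s) = P (setRep α g f) s
    rw [hP]
    split_ifs with hs
    · rfl
    · exact hf _ (by simpa using hs)
  change LinearMap.trace ℂ (level k) _ = _
  rw [h2, h1, LinearMap.trace_eq_matrix_trace ℂ (Pi.basisFun ℂ (Finset α)), Matrix.trace,
    Finset.card_filter, Nat.cast_sum]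
  refine Finset.sum_congr rfl fun s _ => ?_
  rw [Matrix.diag_apply, LinearMap.toMatrix_apply, Pi.basisFun_repr, LinearMap.comp_apply, hP,
    setRep_apply, Pi.basisFun_apply, Pi.single_apply, ← ite_and]
  simp [inv_smul_eq_iff, eq_comm (a := s)]

/-- The lowering operator between consecutive levels. -/
def lowerLevel (k : ℕ) : (level (k + 1) : Submodule ℂ (Finset α → ℂ)) →ₗ[ℂ]
    (level k : Submodule ℂ (Finset α → ℂ)) :=
  lower.restrict fun _ hf => lower_mem_level hf

/-- The raising operator between consecutive levels. -/
def raiseLevel (k : ℕ) : (level k : Submodule ℂ (Finset α → ℂ)) →ₗ[ℂ]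
    (level (k + 1) : Submodule ℂ (Finset α → ℂ)) :=
  raise.restrict fun _ hf => raise_mem_level hf

lemma lowerLevel_comp_raiseLevel_injective {k : ℕ} (hk : 2 * k < Fintype.card α) :
    Function.Injective (lowerLevel (α := α) k ∘ₗ raiseLevel k) := by
  rw [← LinearMap.ker_eq_bot, LinearMap.ker_eq_bot']
  intro f hf
  exact Subtype.ext (eq_zero_of_lower_raise_eq_zero hk f.2 (congrArg Subtype.val hf))

lemma eq_zero_of_forall_perm_of_card_eq {k : ℕ} {f : Finset α → ℂ} (hf : f ∈ level (k + 1))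
    (hlow : lower f = 0) (hk : k < Fintype.card α)
    (hinv : ∀ g : Equiv.Perm α, setRep α g f = f) : f = 0 := by
  obtain ⟨t, ht⟩ := Finset.exists_subset_card_eq (s := (Finset.univ : Finset α)) (n := k)
    (by simpa using hk.le)
  have hconst : ∀ s s' : Finset α, s.card = s'.card → f s = f s' := by
    intro s s' h
    obtain ⟨e⟩ : Nonempty (s ≃ s') := ⟨Finset.equivOfCardEq h⟩
    have := congrFun (hinv e.extendSubtype) s'
    rw [← this, setRep_apply]
    congr 1
    rw [eq_inv_smul_iff]
    refine Finset.eq_of_subset_of_card_le (fun x hx => ?_) (by simp [h])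
    obtain ⟨y, hy, rfl⟩ := Finset.mem_smul_finset.1 hx
    exact e.extendSubtype_mem y hy
  ext s
  by_cases hs : s.card = k + 1
  · have h0 := congrFun hlow t
    rw [lower_apply, Finset.sum_congr rfl fun i hi => hconst (insert i t) s (by
      rw [Finset.card_insert_of_notMem (Finset.mem_compl.1 hi), ht.2, hs]), Finset.sum_const,
      Finset.card_compl, ht.2, nsmul_eq_mul, Pi.zero_apply, mul_eq_zero] at h0
    exact h0.resolve_left (Nat.cast_ne_zero.2 (by omega))
  · exact hf s hs

lemma eq_zero_of_forall_perm_sign {k : ℕ} (hk : 1 < k) {f : Finset α → ℂ} (hf : f ∈ level k)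
    (hinv : ∀ g : Equiv.Perm α, setRep α g f = ((Equiv.Perm.sign g : ℤ) : ℂ) • f) : f = 0 := by
  ext s
  by_cases hs : s.card = k
  · obtain ⟨a, ha, b, hb, hab⟩ := Finset.one_lt_card.1 (hs ▸ hk)
    have h := congrFun (hinv (Equiv.swap a b)) s
    have hfix : (Equiv.swap a b)⁻¹ • s = s := by
      refine Finset.eq_of_subset_of_card_le (fun x hx => ?_) (by simp)
      obtain ⟨y, hy, rfl⟩ := Finset.mem_smul_finset.1 hx
      rw [Equiv.swap_inv, Equiv.Perm.smul_def, Equiv.swap_apply_def]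
      split_ifs <;> assumption
    rw [setRep_apply, hfix, Equiv.Perm.sign_swap hab] at h
    simpa [self_eq_neg] using h
  · exact hf s hs

/-- A permutation of cycle type `(5, 5, 5, 1)`. -/
def threeFiveCycles : Equiv.Perm (Fin 16) :=
  c[0, 1, 2, 3, 4] * c[5, 6, 7, 8, 9] * c[10, 11, 12, 13, 14]

lemma cycleType_threeFiveCycles : threeFiveCycles.cycleType = {5, 5, 5} := by
  have hcyc : ∀ l ∈ [[0, 1, 2, 3, 4], [5, 6, 7, 8, 9], [(10 : Fin 16), 11, 12, 13, 14]],
      l.formPerm.IsCycle ∧ l.formPerm.support.card = 5 := by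
    intro l hl
    have hl' : l.Nodup ∧ l.length = 5 := by revert l; decide
    refine ⟨List.isCycle_formPerm hl'.1 (by omega), ?_⟩
    rw [List.support_formPerm_of_nodup l hl'.1 (fun x hx => by simp [hx] at hl'),
      List.toFinset_card_of_nodup hl'.1, hl'.2]
  have hA := hcyc [0, 1, 2, 3, 4] (by decide)
  have hB := hcyc [5, 6, 7, 8, 9] (by decide)
  have hC := hcyc [10, 11, 12, 13, 14] (by decide)
  have hAB : Equiv.Perm.Disjoint (List.formPerm [0, 1, 2, 3, 4])
      (List.formPerm [5, 6, 7, 8, (9 : Fin 16)]) := by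
    rw [Equiv.Perm.Disjoint]; decide
  have hABC : Equiv.Perm.Disjoint (List.formPerm [0, 1, 2, 3, 4] * List.formPerm [5, 6, 7, 8, 9])
      (List.formPerm [10, 11, 12, 13, (14 : Fin 16)]) := by
    rw [Equiv.Perm.Disjoint]; decide
  change (List.formPerm [0, 1, 2, 3, 4] * List.formPerm [5, 6, 7, 8, 9] *
    List.formPerm [10, 11, 12, 13, (14 : Fin 16)]).cycleType = _
  rw [hABC.cycleType_mul, hAB.cycleType_mul, hA.1.cycleType, hB.1.cycleType, hC.1.cycleType, hA.2,
    hB.2, hC.2]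
  rfl

lemma eq_of_threeFiveCycles_smul_eq {s : Finset (Fin 16)} (hs : threeFiveCycles • s = s)
    (h1 : 1 < s.card) (h2 : s.card ≤ 5) :
    s = {0, 1, 2, 3, 4} ∨ s = {5, 6, 7, 8, 9} ∨ s = {10, 11, 12, 13, 14} := by
  have hpow : ∀ x ∈ s, ∀ n : ℕ, (threeFiveCycles ^ n) x ∈ s := by
    intro x hx n
    induction n with
    | zero => exact hx
    | succ n ih =>
      rw [pow_succ', Equiv.Perm.mul_apply, ← hs]
      exact Finset.smul_mem_smul_finset ih
  obtain ⟨x, hx, hx15⟩ : ∃ x ∈ s, x ≠ 15 := by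
    obtain ⟨a, ha, b, hb, hab⟩ := Finset.one_lt_card.1 h1
    by_cases h : a = 15
    · exact ⟨b, hb, fun hb' => hab (h.trans hb'.symm)⟩
    · exact ⟨a, ha, h⟩
  have key : ∀ x : Fin 16, x ≠ 15 →
      ∃ t ∈ ({{0, 1, 2, 3, 4}, {5, 6, 7, 8, 9}, {10, 11, 12, 13, 14}} : Finset (Finset (Fin 16))),
        t.card = 5 ∧ ∀ y ∈ t, ∃ n < 5, (threeFiveCycles ^ n) x = y := by
    decide
  obtain ⟨t, ht, hc, h⟩ := key x hx15
  have hts : t = s := by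
    refine Finset.eq_of_subset_of_card_le (fun y hy => ?_) (by omega)
    obtain ⟨n, -, rfl⟩ := h y hy
    exact hpow x hx n
  simpa [hts] using ht


lemma filter_threeFiveCycles_five :
    (Finset.univ.filter fun s : Finset (Fin 16) => s.card = 5 ∧ threeFiveCycles • s = s) =
      {{0, 1, 2, 3, 4}, {5, 6, 7, 8, 9}, {10, 11, 12, 13, 14}} := by
  ext s
  simp only [Finset.mem_filter, Finset.mem_univ, true_and, Finset.mem_insert,
    Finset.mem_singleton]
  constructor
  · rintro ⟨hc, hs⟩
    exact eq_of_threeFiveCycles_smul_eq hs (by omega) (by omega)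
  · rintro (rfl | rfl | rfl) <;> decide

lemma filter_threeFiveCycles_four :
    (Finset.univ.filter fun s : Finset (Fin 16) => s.card = 4 ∧ threeFiveCycles • s = s) = ∅ := by
  rw [Finset.filter_eq_empty_iff]
  rintro s - ⟨hc, hs⟩
  obtain rfl | rfl | rfl := eq_of_threeFiveCycles_smul_eq hs (by omega) (by omega) <;>
    exact absurd hc (by decide)

lemma card_filter_one_smul (k : ℕ) :
    (Finset.univ.filter fun s : Finset (Fin 16) =>
      s.card = k ∧ (1 : Equiv.Perm (Fin 16)) • s = s).card = Nat.choose 16 k := by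
  simp only [one_smul, and_true]
  rw [Finset.univ_filter_card_eq, Finset.card_powersetCard, Finset.card_univ, Fintype.card_fin]

lemma fixCount_eq_one {σ : Equiv.Perm (Fin 16)} (hσ : σ.cycleType = {5, 5, 5}) :
    fixCount σ = 1 := by
  have h1 : σ.support.card = 15 := by rw [← Equiv.Perm.sum_cycleType, hσ]; rfl
  have h2 : (Finset.univ.filter fun x => σ x = x) = σ.supportᶜ := by ext x; simp
  rw [fixCount, h2, Finset.card_compl, h1, Fintype.card_fin]

lemma maxF_eq {σ : Equiv.Perm (Fin 16)} (hσ : σ.cycleType = {5, 5, 5}) :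
    maxF 16 σ = 1 / 896 := by
  have h2 : cyc 2 σ = 0 := by rw [cyc, hσ]; rfl
  have h3 : cyc 3 σ = 0 := by rw [cyc, hσ]; rfl
  have h4 : cyc 4 σ = 0 := by rw [cyc, hσ]; rfl
  have hs : Equiv.Perm.sign σ = 1 := by rw [Equiv.Perm.sign_of_cycleType, hσ]; decide
  simp only [maxF, fixCount_eq_one hσ, h2, h3, h4, hs]
  norm_num

lemma lt_levelRep_character :
    1 / 896 * (((levelRep 5).toRepresentation.character (1 : Equiv.Perm (Fin 16))).re -
        ((levelRep 4).toRepresentation.character (1 : Equiv.Perm (Fin 16))).re) <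
      ((levelRep 5).toRepresentation.character threeFiveCycles).re -
        ((levelRep 4).toRepresentation.character threeFiveCycles).re := by
  have h3 : ({{0, 1, 2, 3, 4}, {5, 6, 7, 8, 9}, {10, 11, 12, 13, 14}} :
      Finset (Finset (Fin 16))).card = 3 := by decide
  have h5 : Nat.choose 16 5 = 4368 := by decide
  have h4 : Nat.choose 16 4 = 1820 := by decide
  simp only [levelRep_character, card_filter_one_smul, filter_threeFiveCycles_five,
    filter_threeFiveCycles_four, h3, h4, h5, Complex.natCast_re, Finset.card_empty]
  norm_num

/-- An irreducible constituent of the kernel of the lowering operator on the `5`-subsets. -/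
lemma exists_isNontrivIrr_threeFiveCycles :
    ∃ V : FDRep ℂ (Equiv.Perm (Fin 16)), IsNontrivIrr V ∧
      normChar V threeFiveCycles > 1 / 896 := by
  obtain ⟨X, _, _, _, τ, f, hτ, hf, hfe, hlow, hlt⟩ :=
    Representation.exists_irreducible_of_lt_re_character_sub threeFiveCycles (1 / 896)
      (levelRep 5).toRepresentation (levelRep 4).toRepresentation
      (lowerLevel_comp_raiseLevel_injective (α := Fin 16) (k := 4) (by simp))
      (fun a x => Subtype.ext (lower_setRep a x.1))
      (fun a y => Subtype.ext (raise_setRep a y.1).symm) lt_levelRep_character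
  have hpos : 0 < Module.finrank ℂ X := by
    by_contra! h0
    have := Module.finrank_zero_iff.1 (Nat.le_zero.1 h0)
    have h1 : τ threeFiveCycles = 0 := Subsingleton.elim _ _
    simp [Representation.character, h1, Nat.le_zero.1 h0] at hlt
  have hχ : (FDRep.of τ).character = τ.character := rfl
  have hne : ∀ χ : Equiv.Perm (Fin 16) → ℂ, χ 1 = 1 →
      (∀ v ∈ level 5, lower v = 0 → (∀ g, setRep (Fin 16) g v = χ g • v) → v = 0) →
      τ.character ≠ χ := by
    rintro χ h1 hv rfl
    rw [Representation.char_one, Nat.cast_eq_one] at h1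
    obtain ⟨x, hx⟩ := (Module.finrank_pos_iff_exists_ne_zero (R := ℂ)).1 hpos
    refine hx (hf ((Subtype.ext ?_).trans (map_zero f).symm))
    refine hv (f x).1 (f x).2 (congrArg Subtype.val (hlow x)) fun g => ?_
    have := congrArg Subtype.val (hfe g x)
    rw [Representation.apply_eq_character_smul τ h1, map_smul] at this
    exact this.symm
  refine ⟨FDRep.of τ, ⟨Representation.fdRep_of_simple τ, ?_, ?_⟩, ?_⟩
  · rw [hχ]
    refine hne _ rfl fun v hv hv0 h => eq_zero_of_forall_perm_of_card_eq hv hv0 (by simp) ?_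
    simpa using h
  · rw [hχ]
    exact hne _ (by simp) fun v hv _ h => eq_zero_of_forall_perm_sign (by norm_num) hv h
  · rw [normChar, hχ, Representation.char_one, Complex.div_natCast_re, gt_iff_lt,
      lt_div_iff₀ (by exact_mod_cast hpos)]
    exact hlt

end SetRep

/-- **Counterexample at `n = 16`.** Let `σ ∈ S_16` have cycle type `(5,5,5,1)`, i.e. its
cycle type (as a multiset of cycle lengths `≥ 2`) is `{5,5,5}`. Then
`max {F₁(σ), …, F₈(σ)} = 1/896`, and there is an irreducible character `χ` of `S_16`,
other than trivial and sign, with `χ̃(σ) > 1/896` (namely the one of `(11,5)`). -/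
theorem counterexample_n_sixteen (σ : Equiv.Perm (Fin 16)) (hσ : σ.cycleType = {5, 5, 5}) :
    maxF 16 σ = 1 / 896 ∧
    ∃ V : FDRep ℂ (Equiv.Perm (Fin 16)), IsNontrivIrr V ∧ normChar V σ > 1 / 896 := by
  obtain ⟨V, hV, hlt⟩ := exists_isNontrivIrr_threeFiveCycles
  refine ⟨maxF_eq hσ, V, hV, ?_⟩
  obtain ⟨g, rfl⟩ := isConj_iff.1 (Equiv.Perm.isConj_iff_cycleType_eq.2
    (cycleType_threeFiveCycles.trans hσ.symm))
  rwa [normChar, FDRep.char_conj]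
end
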